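/- Let k ≥ 3 be an odd natural number and r a natural number. If G is a (6k−6+4r)-edge-connected bipartite graph with vertex classes A_1 and A_2 and the number of edges |E(G)| is divisible by k, then the edge set of G can be decomposed into two spanning subgraphs G_1 and G_2 such that, for i = 1, 2, the subgraph G_i is r-edge-connected and the degree in G_i of every vertex of A_i is divisible by k. -/

import Mathlib

open SimpleGraph

/-- A graph `G` is `k`-edge-connected if it remains connected after the deletion of
any fewer than `k` edges. -/
def IsKEdgeConnected {V : Type} (G : SimpleGraph V) (k : ℕ) : Prop :=
  ∀ S : Finset (Sym2 V), S.card < k → (G.deleteEdges ↑S).Connected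

/-! ### Distance to multiples of `2k` -/

def nu (k n : ℤ) : ℤ := min (n % (2 * k)) (2 * k - n % (2 * k))

theorem nu_spec {k : ℤ} (hk : 0 < k) (n : ℤ) :
    0 ≤ nu k n ∧ nu k n ≤ k ∧ ∃ q : ℤ, n = 2 * k * q + nu k n ∨ n = 2 * k * q - nu k n := by
  have h1 := Int.emod_nonneg n (show 2 * k ≠ 0 by omega)
  have h2 := Int.emod_lt_of_pos n (show 0 < 2 * k by omega)
  have h3 := Int.mul_ediv_add_emod n (2 * k)
  unfold nu
  rcases le_total (n % (2 * k)) (2 * k - n % (2 * k)) with h | h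
  · rw [min_eq_left h]
    exact ⟨h1, by omega, n / (2 * k), Or.inl (by omega)⟩
  · rw [min_eq_right h]
    refine ⟨by omega, by omega, n / (2 * k) + 1, Or.inr ?_⟩
    rw [mul_add]; omega

theorem nu_le {k : ℤ} (hk : 0 < k) (n q : ℤ) : nu k n ≤ |n - 2 * k * q| := by
  obtain ⟨h0, h1, p, hp⟩ := nu_spec hk n
  rcases lt_trichotomy p q with h | h | h
  · have : 2 * k * (p + 1) ≤ 2 * k * q := by
      apply mul_le_mul_of_nonneg_left <;> omega
    rw [mul_add] at this
    have := neg_abs_le (n - 2 * k * q)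
    omega
  · subst h
    rcases hp with hp | hp
    · have := le_abs_self (n - 2 * k * p); omega
    · have := neg_abs_le (n - 2 * k * p); omega
  · have : 2 * k * (q + 1) ≤ 2 * k * p := by
      apply mul_le_mul_of_nonneg_left <;> omega
    rw [mul_add] at this
    have := le_abs_self (n - 2 * k * q)
    omega

theorem nu_nonneg {k : ℤ} (hk : 0 < k) (n : ℤ) : 0 ≤ nu k n := (nu_spec hk n).1
theorem nu_le_k {k : ℤ} (hk : 0 < k) (n : ℤ) : nu k n ≤ k := (nu_spec hk n).2.1

theorem nu_lip {k : ℤ} (hk : 0 < k) (n n' : ℤ) : nu k n' ≤ nu k n + |n' - n| := by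
  obtain ⟨h0, h1, p, hp⟩ := nu_spec hk n
  refine (nu_le hk n' p).trans ?_
  have h2 := le_abs_self (n' - n)
  have h3 := neg_abs_le (n' - n)
  rw [abs_le]
  omega

theorem nu_congr {k : ℤ} (hk : 0 < k) {n n' : ℤ} (h : 2 * k ∣ n - n') : nu k n = nu k n' := by
  obtain ⟨c, hc⟩ := h
  have key : ∀ a b c : ℤ, a - b = 2 * k * c → nu k a ≤ nu k b := by
    intro a b c hc
    obtain ⟨h0, h1, p, hp⟩ := nu_spec hk b
    refine (nu_le hk a (p + c)).trans ?_
    rw [mul_add, abs_le]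
    omega
  refine le_antisymm (key _ _ c hc) (key _ _ (-c) ?_)
  rw [mul_neg]; omega

theorem nu_neg {k : ℤ} (hk : 0 < k) (n : ℤ) : nu k (-n) = nu k n := by
  have key : ∀ a : ℤ, nu k (-a) ≤ nu k a := by
    intro a
    obtain ⟨h0, h1, p, hp⟩ := nu_spec hk a
    refine (nu_le hk (-a) (-p)).trans ?_
    rw [mul_neg, abs_le]
    omega
  refine le_antisymm (key n) ?_
  have := key (-n)
  rwa [neg_neg] at this

theorem nu_even {k : ℤ} (hk : 0 < k) (n : ℤ) : 2 ∣ n + nu k n := by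
  obtain ⟨h0, h1, p, hp⟩ := nu_spec hk n
  rcases hp with hp | hp
  · exact ⟨k * p + nu k n, by rw [mul_add, ← mul_assoc]; omega⟩
  · exact ⟨k * p, by rw [← mul_assoc]; omega⟩

theorem nu_step {k : ℤ} (hk : 0 < k) (n : ℤ) (h : nu k n ≠ 0) :
    nu k (n - 1) ≤ nu k n - 1 ∨ nu k (n + 1) ≤ nu k n - 1 := by
  obtain ⟨h0, h1, p, hp⟩ := nu_spec hk n
  rcases hp with hp | hp
  · left
    refine (nu_le hk _ p).trans ?_
    rw [abs_le]; omega
  · right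
    refine (nu_le hk _ p).trans ?_
    rw [abs_le]; omega

theorem nu_eq_zero {k : ℤ} (hk : 0 < k) {n : ℤ} (h : nu k n = 0) : 2 * k ∣ n := by
  obtain ⟨h0, h1, p, hp⟩ := nu_spec hk n
  exact ⟨p, by omega⟩

theorem nu_of_dvd {k : ℤ} (hk : 0 < k) {n : ℤ} (h : 2 * k ∣ n) : nu k n = 0 := by
  obtain ⟨c, hc⟩ := h
  have := nu_le hk n c
  have h0 := nu_nonneg hk n
  rw [hc, sub_self, abs_zero] at this
  rw [hc] at h0 ⊢
  omega

/-- admissible pairs (number of arcs leaving the root, number of arcs entering it) -/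
def SS (k a b : ℤ) : Prop := (a ≤ 2 * k - 1 ∧ b ≤ k - 1) ∨ (a ≤ k - 1 ∧ b ≤ 2 * k - 1)

theorem SS_lemma {k a b : ℤ} (hk : 0 < k) (ha : 0 ≤ a) (hb : 0 ≤ b) (h : SS k a b) :
    a + b - nu k (b - a) ≤ 2 * k - 2 := by
  obtain ⟨h0, h1, p, hp⟩ := nu_spec hk (b - a)
  rcases lt_trichotomy p 0 with hq | hq | hq
  · have h2 : 2 * k * p ≤ 2 * k * (-1) := by
      apply mul_le_mul_of_nonneg_left <;> omega
    unfold SS at h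
    omega
  · subst hq
    unfold SS at h
    omega
  · have h2 : 2 * k * 1 ≤ 2 * k * p := by
      apply mul_le_mul_of_nonneg_left <;> omega
    unfold SS at h
    omega

theorem SS_of_tight {k a b n : ℤ} (hk : 0 < k) (ha : 0 ≤ a) (hb : 0 ≤ b)
    (h : a + b = 2 * k - 2 + nu k n) (h' : 2 * k ∣ b - a - n) : SS k a b := by
  obtain ⟨h0, h1, p, hp⟩ := nu_spec hk n
  obtain ⟨c, hc⟩ := h'
  have h3 : b - a = 2 * k * (p + c) + nu k n ∨ b - a = 2 * k * (p + c) - nu k n := by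
    rw [mul_add]; omega
  generalize p + c = q at h3
  unfold SS
  rcases lt_trichotomy q (-1) with hq | hq | hq
  · have h2 : 2 * k * q ≤ 2 * k * (-2) := by
      apply mul_le_mul_of_nonneg_left <;> omega
    omega
  · subst hq; omega
  · rcases lt_trichotomy q 1 with hq' | hq' | hq'
    · obtain rfl : q = 0 := by omega
      omega
    · subst hq'; omega
    · have h2 : 2 * k * 2 ≤ 2 * k * q := by
        apply mul_le_mul_of_nonneg_left <;> omega
      omega

structure Cfg (V : Type) where
  m : V → V → ℤ
  t : V → ℤ
  a : V → ℤ
  b : V → ℤ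

section PartA
open Finset
variable {V : Type} [DecidableEq V]

def dd (W A : Finset V) (m : V → V → ℤ) : ℤ := ∑ u ∈ A, ∑ v ∈ W \ A, m u v

def Cfg.D (c : Cfg V) (W A : Finset V) : ℤ := dd W A c.m + ∑ v ∈ A, c.a v + ∑ v ∈ A, c.b v

def Cfg.ta (c : Cfg V) (A : Finset V) : ℤ := ∑ v ∈ A, c.t v + ∑ v ∈ A, c.b v - ∑ v ∈ A, c.a v

def Sol (k : ℤ) (W : Finset V) (m : V → V → ℤ) (t : V → ℤ) : Prop :=
  ∃ o : V → V → ℤ, (∀ u ∈ W, ∀ v ∈ W, 0 ≤ o u v) ∧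
    (∀ u ∈ W, ∀ v ∈ W, u ≠ v → o u v + o v u = m u v) ∧
    ∀ u ∈ W, 2 * k ∣ ∑ v ∈ W, (o u v - o v u) - t u

structure Base (k : ℤ) (W : Finset V) (c : Cfg V) : Prop where
  sym : ∀ u v, c.m u v = c.m v u
  nn : ∀ u v, 0 ≤ c.m u v
  an : ∀ v, 0 ≤ c.a v
  bn : ∀ v, 0 ≤ c.b v
  tot : 2 * k ∣ ∑ v ∈ W, c.t v
  par : ∀ A ⊆ W, 2 ∣ dd W A c.m + ∑ v ∈ A, c.t v
  ss : SS k (∑ v ∈ W, c.a v) (∑ v ∈ W, c.b v)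

/-- the gap of a set is nonnegative -/
def Ok (k : ℤ) (W : Finset V) (c : Cfg V) (A : Finset V) : Prop :=
  2 * k - 2 + nu k (c.ta A) ≤ c.D W A

theorem gap_even {k : ℤ} (hk : 0 < k) {W : Finset V} {c : Cfg V} (hb : Base k W c)
    {A : Finset V} (hA : A ⊆ W) : 2 ∣ c.D W A - (2 * k - 2 + nu k (c.ta A)) := by
  have h1 := hb.par A hA
  have h2 := nu_even hk (c.ta A)
  unfold Cfg.D
  unfold Cfg.ta at *
  omega

/-- splitting lemma for `D` -/
theorem dd_union {W A B : Finset V} {m : V → V → ℤ} (hs : ∀ u v, m u v = m v u) (hA : A ⊆ W)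
    (hB : B ⊆ W) (hAB : Disjoint A B) :
    dd W (A ∪ B) m = dd W A m + dd W B m - 2 * ∑ u ∈ A, ∑ v ∈ B, m u v := by
  unfold dd
  rw [sum_union hAB]
  have e1 : W \ A = (W \ (A ∪ B)) ∪ B := by
    ext v; simp only [mem_sdiff, mem_union]
    constructor
    · rintro ⟨h1, h2⟩; by_cases h : v ∈ B <;> simp [*]
    · rintro (⟨h1, h2⟩ | h)
      · exact ⟨h1, fun h => h2 (Or.inl h)⟩
      · exact ⟨hB h, fun h' => (Finset.disjoint_left.mp hAB h') h⟩
  have e2 : W \ B = (W \ (A ∪ B)) ∪ A := by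
    ext v; simp only [mem_sdiff, mem_union]
    constructor
    · rintro ⟨h1, h2⟩; by_cases h : v ∈ A <;> simp [*]
    · rintro (⟨h1, h2⟩ | h)
      · exact ⟨h1, fun h => h2 (Or.inr h)⟩
      · exact ⟨hA h, fun h' => (Finset.disjoint_left.mp hAB h) h'⟩
  have d1 : Disjoint (W \ (A ∪ B)) B := by
    rw [Finset.disjoint_left]; intro v hv hb; simp at hv; exact hv.2.2 hb
  have d2 : Disjoint (W \ (A ∪ B)) A := by
    rw [Finset.disjoint_left]; intro v hv hb; simp at hv; exact hv.2.1 hb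
  have h3 : ∑ u ∈ A, ∑ v ∈ W \ A, m u v
      = ∑ u ∈ A, ∑ v ∈ W \ (A ∪ B), m u v + ∑ u ∈ A, ∑ v ∈ B, m u v := by
    rw [e1, ← sum_add_distrib]
    exact sum_congr rfl fun u _ => sum_union d1
  have h4 : ∑ u ∈ B, ∑ v ∈ W \ B, m u v
      = ∑ u ∈ B, ∑ v ∈ W \ (A ∪ B), m u v + ∑ u ∈ A, ∑ v ∈ B, m u v := by
    rw [e2, sum_comm (s := A), ← sum_add_distrib]
    refine sum_congr rfl fun u _ => ?_
    rw [sum_union d2]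
    congr 1
    exact sum_congr rfl fun v _ => hs _ _
  rw [h3, h4]; ring

theorem dd_compl {W A : Finset V} {m : V → V → ℤ} (hs : ∀ u v, m u v = m v u) (hA : A ⊆ W) :
    dd W (W \ A) m = dd W A m := by
  unfold dd
  rw [Finset.sdiff_sdiff_eq_self hA, sum_comm]
  exact sum_congr rfl fun u _ => sum_congr rfl fun v _ => hs _ _

theorem dd_restrict {W A B : Finset V} {m : V → V → ℤ} (hA : A ⊆ W) (hB : B ⊆ A) :
    dd W B m = dd A B m + ∑ u ∈ B, ∑ v ∈ W \ A, m u v := by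
  unfold dd
  rw [← sum_add_distrib]
  refine sum_congr rfl fun u _ => ?_
  rw [← sum_union]
  · congr 1
    ext v; simp only [mem_sdiff, mem_union]
    constructor
    · rintro ⟨h1, h2⟩; by_cases h : v ∈ A <;> simp [*]
    · rintro (⟨h1, h2⟩ | ⟨h1, h2⟩)
      · exact ⟨hA h1, h2⟩
      · exact ⟨h1, fun h => h2 (hB h)⟩
  · rw [Finset.disjoint_left]; intro v hv hb; simp at hv hb; exact hb.2 hv.1

theorem distribute (s : Finset V) (m : V → ℤ) (hm : ∀ v ∈ s, 0 ≤ m v) (n : ℤ) (h0 : 0 ≤ n)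
    (h1 : n ≤ ∑ v ∈ s, m v) :
    ∃ c : V → ℤ, (∀ v ∈ s, 0 ≤ c v ∧ c v ≤ m v) ∧ ∑ v ∈ s, c v = n := by
  induction s using Finset.induction_on generalizing n with
  | empty => exact ⟨fun _ => 0, by simp, by simp at h1 ⊢; omega⟩
  | insert x s hx ih =>
    rw [sum_insert hx] at h1
    have hmx := hm x (mem_insert_self _ _)
    have hms : 0 ≤ ∑ v ∈ s, m v := sum_nonneg fun v hv => hm v (mem_insert_of_mem hv)
    obtain ⟨c, hc, hcs⟩ := ih (fun v hv => hm v (mem_insert_of_mem hv)) (max 0 (n - m x))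
      (by omega) (by omega)
    refine ⟨fun v => if v = x then min n (m x) else c v, ?_, ?_⟩
    · intro v hv
      by_cases h : v = x
      · subst h; simp; omega
      · simp only [h, if_false]
        exact hc v (mem_of_mem_insert_of_ne hv h)
    · rw [sum_insert hx, if_pos rfl]
      rw [sum_congr rfl (g := c), hcs]
      · omega
      · intro v hv
        rw [if_neg]; rintro rfl; exact hx hv

/-! ### contraction -/

def Fb (A : Finset V) (a0 u : V) : Finset V := if u = a0 then A else {u}

def cW (W A : Finset V) (a0 : V) : Finset V := insert a0 (W \ A)

def pre (A : Finset V) (a0 : V) (B : Finset V) : Finset V := B.biUnion (Fb A a0)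

def Cfg.ctr (c : Cfg V) (A : Finset V) (a0 : V) : Cfg V where
  m u v := ∑ p ∈ Fb A a0 u, ∑ q ∈ Fb A a0 v, c.m p q
  t u := ∑ p ∈ Fb A a0 u, c.t p
  a u := ∑ p ∈ Fb A a0 u, c.a p
  b u := ∑ p ∈ Fb A a0 u, c.b p

theorem mem_pre {W A B : Finset V} {a0 : V} (ha : a0 ∈ A) (hB : B ⊆ cW W A a0) (v : V) :
    v ∈ pre A a0 B ↔ (v ∈ A ∧ a0 ∈ B) ∨ (v ∉ A ∧ v ∈ B) := by
  unfold pre Fb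
  simp only [mem_biUnion]
  constructor
  · rintro ⟨u, hu, hv⟩
    by_cases h : u = a0
    · subst h; simp at hv; exact Or.inl ⟨hv, hu⟩
    · simp [h] at hv
      subst hv
      have := hB hu
      simp [cW, h] at this
      exact Or.inr ⟨this.2, hu⟩
  · rintro (⟨h1, h2⟩ | ⟨h1, h2⟩)
    · exact ⟨a0, h2, by simpa⟩
    · refine ⟨v, h2, ?_⟩
      rw [if_neg]; simp
      rintro rfl; exact h1 ha

theorem Fb_disj {W A B : Finset V} {a0 : V} (hB : B ⊆ cW W A a0) :
    (B : Set V).PairwiseDisjoint (Fb A a0) := by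
  intro u hu v hv huv
  have h1 := hB hu
  have h2 := hB hv
  simp only [cW, mem_insert, mem_sdiff] at h1 h2
  change Disjoint _ _
  unfold Fb
  rw [Finset.disjoint_left]
  intro w
  by_cases h : u = a0 <;> by_cases h' : v = a0
  · exact absurd (h.trans h'.symm) huv
  · simp only [h, h', if_true, if_false, mem_singleton]
    rintro h3 rfl; tauto
  · simp only [h, h', if_true, if_false, mem_singleton]
    rintro rfl h3; tauto
  · simp only [h, h', if_false, mem_singleton]
    rintro rfl h3; tauto

theorem sum_pre {W A B : Finset V} {a0 : V} (hB : B ⊆ cW W A a0) (f : V → ℤ) :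
    ∑ v ∈ pre A a0 B, f v = ∑ u ∈ B, ∑ p ∈ Fb A a0 u, f p :=
  sum_biUnion (Fb_disj hB)

theorem pre_cW {W A : Finset V} {a0 : V} (ha : a0 ∈ A) (hA : A ⊆ W) :
    pre A a0 (cW W A a0) = W := by
  ext v
  rw [mem_pre ha (Subset.refl _)]
  simp only [cW, mem_insert, mem_sdiff]
  constructor
  · rintro (⟨h, _⟩ | ⟨h1, rfl | h2⟩)
    · exact hA h
    · exact absurd ha h1
    · exact h2.1
  · intro h; by_cases h' : v ∈ A <;> simp [*]

theorem pre_sub {W A B : Finset V} {a0 : V} (ha : a0 ∈ A) (hA : A ⊆ W) (hB : B ⊆ cW W A a0) :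
    pre A a0 B ⊆ W := by
  conv_rhs => rw [← pre_cW ha hA]
  exact biUnion_subset_biUnion_of_subset_left _ hB

theorem pre_sdiff {W A B : Finset V} {a0 : V} (ha : a0 ∈ A) (hA : A ⊆ W)
    (hB : B ⊆ cW W A a0) : pre A a0 (cW W A a0 \ B) = W \ pre A a0 B := by
  ext v
  rw [mem_pre ha sdiff_subset]
  simp only [mem_sdiff, mem_pre ha hB]
  simp only [cW, mem_insert, mem_sdiff]
  constructor
  · rintro (⟨h1, h2⟩ | ⟨h1, h2⟩)
    · exact ⟨hA h1, by tauto⟩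
    · have : v ≠ a0 := by rintro rfl; exact h1 ha
      tauto
  · rintro ⟨h1, h2⟩
    by_cases h : v ∈ A
    · left; tauto
    · have : v ≠ a0 := by rintro rfl; exact h ha
      tauto

theorem pre_inj {W A B : Finset V} {a0 : V} (ha : a0 ∈ A) (hA : A ⊆ W)
    (hB : B ⊆ cW W A a0) (h : pre A a0 B = W) : B = cW W A a0 := by
  refine Subset.antisymm hB ?_
  intro v hv
  have h1 : v ∈ W := by
    rw [cW, mem_insert, mem_sdiff] at hv
    rcases hv with rfl | hv
    exacts [hA ha, hv.1]
  rw [← h, mem_pre ha hB] at h1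
  rw [cW, mem_insert, mem_sdiff] at hv
  rcases hv with rfl | hv
  · tauto
  · tauto

theorem pre_nonempty {W A B : Finset V} {a0 : V} (ha : a0 ∈ A)
    (hB : B ⊆ cW W A a0) (h : B.Nonempty) : (pre A a0 B).Nonempty := by
  obtain ⟨v, hv⟩ := h
  by_cases h : v = a0
  · subst h
    exact ⟨v, by rw [mem_pre ha hB]; tauto⟩
  · refine ⟨v, ?_⟩
    have := hB hv
    rw [cW, mem_insert, mem_sdiff] at this
    rw [mem_pre ha hB]; tauto

theorem ctr_dd {W A B : Finset V} {a0 : V} (c : Cfg V) (ha : a0 ∈ A) (hA : A ⊆ W)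
    (hB : B ⊆ cW W A a0) : dd (cW W A a0) B (c.ctr A a0).m = dd W (pre A a0 B) c.m := by
  unfold dd
  rw [← pre_sdiff ha hA hB, sum_pre hB]
  refine sum_congr rfl fun u _ => ?_
  simp only [Cfg.ctr]
  rw [sum_comm]
  refine sum_congr rfl fun p _ => ?_
  rw [sum_pre sdiff_subset]

theorem ctr_D {W A B : Finset V} {a0 : V} (c : Cfg V) (ha : a0 ∈ A) (hA : A ⊆ W)
    (hB : B ⊆ cW W A a0) : (c.ctr A a0).D (cW W A a0) B = c.D W (pre A a0 B) := by
  unfold Cfg.D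
  rw [ctr_dd c ha hA hB, sum_pre hB, sum_pre hB]; rfl

theorem ctr_ta {W A B : Finset V} {a0 : V} (c : Cfg V)
    (hB : B ⊆ cW W A a0) : (c.ctr A a0).ta B = c.ta (pre A a0 B) := by
  unfold Cfg.ta
  rw [sum_pre hB, sum_pre hB, sum_pre hB]; rfl

theorem ctr_ok {k : ℤ} {W A B : Finset V} {a0 : V} {c : Cfg V} (ha : a0 ∈ A) (hA : A ⊆ W)
    (hB : B ⊆ cW W A a0) (h : Ok k W c (pre A a0 B)) : Ok k (cW W A a0) (c.ctr A a0) B := by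
  unfold Ok
  rw [ctr_D c ha hA hB, ctr_ta c hB]; exact h

theorem ctr_base {k : ℤ} {W A : Finset V} {a0 : V} {c : Cfg V} (ha : a0 ∈ A) (hA : A ⊆ W)
    (hb : Base k W c) : Base k (cW W A a0) (c.ctr A a0) where
  sym u v := by
    simp only [Cfg.ctr]
    rw [sum_comm]
    exact sum_congr rfl fun _ _ => sum_congr rfl fun _ _ => hb.sym _ _
  nn u v := sum_nonneg fun _ _ => sum_nonneg fun _ _ => hb.nn _ _
  an u := sum_nonneg fun _ _ => hb.an _
  bn u := sum_nonneg fun _ _ => hb.bn _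
  tot := by
    have := hb.tot
    rwa [← pre_cW ha hA, sum_pre (Subset.refl _)] at this
  par B hB := by
    have := hb.par _ (pre_sub ha hA hB)
    rw [← ctr_dd c ha hA hB, sum_pre hB] at this
    exact this
  ss := by
    have := hb.ss
    rwa [← pre_cW ha hA, sum_pre (Subset.refl _), sum_pre (Subset.refl _)] at this

theorem sol_of_tight {k : ℤ} (hk : 0 < k) {W A : Finset V} {a0 : V} {c : Cfg V} (ha : a0 ∈ A)
    (hA : A ⊆ W) (hb : Base k W c) (htight : c.D W A = 2 * k - 2 + nu k (c.ta A))
    (hC : Sol k (cW W A a0) (c.ctr A a0).m (c.ctr A a0).t)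
    (hS : ∀ c' : Cfg V, c'.m = c.m → Base k A c' →
      (∀ B ⊆ A, c'.D A B = c.D W B ∧ c'.ta B = c.ta B) → Sol k A c'.m c'.t) :
    Sol k W c.m c.t := by
  obtain ⟨o', ho0, ho1, ho2⟩ := hC
  have ha0 : a0 ∈ cW W A a0 := mem_insert_self _ _
  have hcv : ∀ v ∈ W \ A, v ∈ cW W A a0 := fun v hv => mem_insert_of_mem hv
  have hne : ∀ v ∈ W \ A, v ≠ a0 := by
    rintro v hv rfl; exact (mem_sdiff.mp hv).2 ha
  have hm1 : ∀ v ∈ W \ A, (c.ctr A a0).m a0 v = ∑ u ∈ A, c.m u v := by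
    intro v hv
    simp [Cfg.ctr, Fb, hne v hv]
  have hex : ∀ v, ∃ f : V → ℤ, v ∈ W \ A → (∀ u ∈ A, 0 ≤ f u ∧ f u ≤ c.m u v) ∧
      ∑ u ∈ A, f u = o' a0 v := by
    intro v
    by_cases hv : v ∈ W \ A
    · obtain ⟨f, hf⟩ := distribute A (fun u => c.m u v) (fun u _ => hb.nn u v) (o' a0 v)
        (ho0 _ ha0 _ (hcv v hv)) (by
          have h1 := ho1 a0 ha0 v (hcv v hv) (hne v hv).symm
          have h2 := ho0 v (hcv v hv) a0 ha0
          rw [hm1 v hv] at h1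
          omega)
      exact ⟨f, fun _ => hf⟩
    · exact ⟨fun _ => 0, fun h => absurd h hv⟩
  choose g hg using hex
  -- `g v u` : number of edges oriented from `u ∈ A` to `v ∈ W \ A`
  have hgo : ∀ v ∈ W \ A, ∑ u ∈ A, (2 * g v u - c.m u v) = o' a0 v - o' v a0 := by
    intro v hv
    have h1 := ho1 a0 ha0 v (hcv v hv) (hne v hv).symm
    rw [hm1 v hv] at h1
    rw [sum_sub_distrib, ← mul_sum, (hg v hv).2]
    omega
  have hsumcW : ∀ f : V → ℤ, f a0 = 0 → ∑ v ∈ cW W A a0, f v = ∑ v ∈ W \ A, f v := by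
    intro f hf
    rw [cW, sum_insert (fun h => (mem_sdiff.mp h).2 ha), hf, zero_add]
  have hta0 : (c.ctr A a0).t a0 = ∑ u ∈ A, c.t u := by simp [Cfg.ctr, Fb]
  have htot : 2 * k ∣ ∑ u ∈ A, (c.t u - ∑ v ∈ W \ A, (2 * g v u - c.m u v)) := by
    have h1 := ho2 a0 ha0
    rw [hsumcW _ (by ring), hta0, sum_congr rfl fun v hv => (hgo v hv).symm, sum_comm] at h1
    rw [sum_sub_distrib, ← dvd_neg, neg_sub]
    exact h1
  let c' : Cfg V :=
    { m := c.m
      t := fun u => c.t u - ∑ v ∈ W \ A, (2 * g v u - c.m u v)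
      a := fun u => c.a u + if u ∈ A then ∑ v ∈ W \ A, (c.m u v - g v u) else 0
      b := fun u => c.b u + if u ∈ A then ∑ v ∈ W \ A, g v u else 0 }
  have hBa : ∀ B ⊆ A, ∑ u ∈ B, c'.a u
      = ∑ u ∈ B, c.a u + ∑ u ∈ B, ∑ v ∈ W \ A, c.m u v - ∑ u ∈ B, ∑ v ∈ W \ A, g v u := by
    intro B hB
    rw [← sum_add_distrib, ← sum_sub_distrib]
    refine sum_congr rfl fun u hu => ?_
    simp only [c', if_pos (hB hu), sum_sub_distrib]; ring
  have hBb : ∀ B ⊆ A, ∑ u ∈ B, c'.b u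
      = ∑ u ∈ B, c.b u + ∑ u ∈ B, ∑ v ∈ W \ A, g v u := by
    intro B hB
    rw [← sum_add_distrib]
    refine sum_congr rfl fun u hu => ?_
    simp only [c', if_pos (hB hu)]
  have hBt : ∀ B ⊆ A, ∑ u ∈ B, c'.t u
      = ∑ u ∈ B, c.t u + ∑ u ∈ B, ∑ v ∈ W \ A, c.m u v - 2 * ∑ u ∈ B, ∑ v ∈ W \ A, g v u := by
    intro B hB
    rw [mul_sum, ← sum_add_distrib, ← sum_sub_distrib]
    refine sum_congr rfl fun u hu => ?_
    simp only [c', sum_sub_distrib, mul_sum]; ring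
  have hkey : ∀ B ⊆ A, c'.D A B = c.D W B ∧ c'.ta B = c.ta B := by
    intro B hB
    unfold Cfg.D Cfg.ta
    rw [hBa B hB, hBb B hB, hBt B hB, dd_restrict (m := c.m) hA hB]
    constructor <;> ring
  have hbase : Base k A c' := by
    refine ⟨hb.sym, hb.nn, ?_, ?_, htot, ?_, ?_⟩
    · intro u
      refine add_nonneg (hb.an u) ?_
      split_ifs with hu
      · exact sum_nonneg fun v hv => sub_nonneg.mpr ((hg v hv).1 u hu).2
      · exact le_rfl
    · intro u
      refine add_nonneg (hb.bn u) ?_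
      split_ifs with hu
      · exact sum_nonneg fun v hv => ((hg v hv).1 u hu).1
      · exact le_rfl
    · intro B hB
      have h1 := hb.par B (hB.trans hA)
      rw [hBt B hB]
      rw [dd_restrict hA hB] at h1
      change 2 ∣ dd A B c.m + _
      omega
    · obtain ⟨h1, h2⟩ := hkey A (Subset.refl _)
      have h3 : dd A A c'.m = 0 := by simp [dd]
      refine SS_of_tight hk (n := c.ta A) (sum_nonneg fun u hu => ?_)
        (sum_nonneg fun u hu => ?_) ?_ ?_
      · refine add_nonneg (hb.an u) ?_
        rw [if_pos hu]
        exact sum_nonneg fun v hv => sub_nonneg.mpr ((hg v hv).1 u hu).2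
      · refine add_nonneg (hb.bn u) ?_
        rw [if_pos hu]
        exact sum_nonneg fun v hv => ((hg v hv).1 u hu).1
      · rw [← htight, ← h1, Cfg.D, h3]; ring
      · rw [← h2, Cfg.ta]
        have : 2 * k ∣ ∑ u ∈ A, c'.t u := htot
        rw [show ∀ x y z : ℤ, y - x - (z + y - x) = -z from fun _ _ _ => by ring, dvd_neg]
        exact this
  obtain ⟨o, hs0, hs1, hs2⟩ := hS c' rfl hbase hkey
  have hsW : ∀ f : V → ℤ, ∑ v ∈ W, f v = ∑ v ∈ A, f v + ∑ v ∈ W \ A, f v := by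
    intro f; rw [add_comm, sum_sdiff hA]
  refine ⟨fun u v => if u ∈ A then (if v ∈ A then o u v else g v u) else
    (if v ∈ A then c.m v u - g u v else o' u v), ?_, ?_, ?_⟩
  · intro u hu v hv
    by_cases h1 : u ∈ A <;> by_cases h2 : v ∈ A <;> simp only [h1, h2, if_true, if_false]
    · exact hs0 u h1 v h2
    · exact ((hg v (mem_sdiff.mpr ⟨hv, h2⟩)).1 u h1).1
    · exact sub_nonneg.mpr ((hg u (mem_sdiff.mpr ⟨hu, h1⟩)).1 v h2).2
    · exact ho0 u (hcv _ (mem_sdiff.mpr ⟨hu, h1⟩)) v (hcv _ (mem_sdiff.mpr ⟨hv, h2⟩))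
  · intro u hu v hv huv
    by_cases h1 : u ∈ A <;> by_cases h2 : v ∈ A <;> simp only [h1, h2, if_true, if_false]
    · exact hs1 u h1 v h2 huv
    · ring
    · rw [hb.sym u v]; ring
    · have h1' := mem_sdiff.mpr ⟨hu, h1⟩
      have h2' := mem_sdiff.mpr ⟨hv, h2⟩
      rw [ho1 u (hcv _ h1') v (hcv _ h2') huv]
      simp [Cfg.ctr, Fb, hne u h1', hne v h2']
  · intro u hu
    rw [hsW]
    by_cases h1 : u ∈ A
    · have := hs2 u h1
      convert this using 1
      simp only [c', h1, if_true]
      rw [sum_congr rfl (g := fun v => o u v - o v u), sum_congr (s₁ := W \ A) rfl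
        (g := fun v => 2 * g v u - c.m u v)]
      · ring
      · intro v hv
        simp only [(mem_sdiff.mp hv).2, if_false]; ring
      · intro v hv
        simp only [hv, if_true]
    · have h1' := mem_sdiff.mpr ⟨hu, h1⟩
      have := ho2 u (hcv _ h1')
      have e : (c.ctr A a0).t u = c.t u := by simp [Cfg.ctr, Fb, hne u h1']
      rw [e] at this
      convert this using 2
      rw [cW, sum_insert (fun h => (mem_sdiff.mp h).2 ha)]
      simp only [h1, if_false]
      congr 1
      · have h3 := hgo u h1'
        rw [← neg_sub (o' a0 u), ← h3, ← sum_neg_distrib]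
        refine sum_congr rfl fun v hv => ?_
        simp only [hv, if_true]; ring
      · refine sum_congr rfl fun v hv => ?_
        simp only [(mem_sdiff.mp hv).2, if_false]

end PartA

section PartA2
open Finset
set_option linter.unusedSectionVars false
variable {V : Type} [DecidableEq V]

def dl (x u : V) : ℤ := if u = x then 1 else 0

def Ed (x y u v : V) : ℤ := dl x u * dl y v + dl y u * dl x v

theorem sum_dl (x : V) (A : Finset V) : ∑ u ∈ A, dl x u = if x ∈ A then 1 else 0 := by
  unfold dl; rw [sum_ite_eq']

theorem dd_Ed {W A : Finset V} {x y : V} (hx : x ∈ W) (hy : y ∈ W) :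
    dd W A (Ed x y) = if (x ∈ A ↔ y ∈ A) then 0 else 1 := by
  unfold dd Ed
  simp only [sum_add_distrib, ← mul_sum, ← sum_mul, sum_dl, mem_sdiff]
  by_cases h1 : x ∈ A <;> by_cases h2 : y ∈ A <;> simp [*]

theorem dd_add (W A : Finset V) (m m' : V → V → ℤ) :
    dd W A (fun u v => m u v + m' u v) = dd W A m + dd W A m' := by
  unfold dd; simp only [sum_add_distrib]

theorem dd_sub (W A : Finset V) (m m' : V → V → ℤ) :
    dd W A (fun u v => m u v - m' u v) = dd W A m - dd W A m' := by
  unfold dd; simp only [sum_sub_distrib]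

def Mt (W : Finset V) (m : V → V → ℤ) : ℤ := ∑ u ∈ W, ∑ v ∈ W, m u v

theorem Mt_Ed {W : Finset V} {x y : V} (hx : x ∈ W) (hy : y ∈ W) : Mt W (Ed x y) = 2 := by
  unfold Mt Ed
  simp only [sum_add_distrib, ← mul_sum, ← sum_mul, sum_dl, hx, hy]
  norm_num

theorem Mt_add (W : Finset V) (m m' : V → V → ℤ) :
    Mt W (fun u v => m u v + m' u v) = Mt W m + Mt W m' := by
  unfold Mt; simp only [sum_add_distrib]

theorem Mt_sub (W : Finset V) (m m' : V → V → ℤ) :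
    Mt W (fun u v => m u v - m' u v) = Mt W m - Mt W m' := by
  unfold Mt; simp only [sum_sub_distrib]

theorem Mt_nonneg {W : Finset V} {m : V → V → ℤ} (h : ∀ u v, 0 ≤ m u v) : 0 ≤ Mt W m :=
  sum_nonneg fun _ _ => sum_nonneg fun _ _ => h _ _

theorem Ed_symm (x y u v : V) : Ed x y u v = Ed x y v u := by unfold Ed; ring

theorem dl_nonneg (x u : V) : 0 ≤ dl x u := by unfold dl; split_ifs <;> norm_num

theorem Ed_nonneg (x y u v : V) : 0 ≤ Ed x y u v := by
  unfold Ed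
  have := dl_nonneg x u; have := dl_nonneg y u; have := dl_nonneg x v; have := dl_nonneg y v
  positivity

theorem Ed_le {m : V → V → ℤ} (hs : ∀ u v, m u v = m v u) (hn : ∀ u v, 0 ≤ m u v) {x y : V}
    (hxy : x ≠ y) {r : ℤ} (h : r ≤ m x y) (u v : V) : 0 ≤ m u v - r * Ed x y u v := by
  have h1 := hn u v
  unfold Ed dl
  by_cases e1 : u = x <;> by_cases e2 : v = y <;> by_cases e3 : u = y <;> by_cases e4 : v = x <;>
    simp [*] <;> subst_vars <;> first | exact absurd rfl hxy | omega | (rw [hs]; omega) | skip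
  all_goals simp_all

theorem sol_orient {k : ℤ} {W : Finset V} {m : V → V → ℤ} {t : V → ℤ} {x y : V} (hx : x ∈ W)
    (hy : y ∈ W)
    (h : Sol k W (fun u v => m u v - Ed x y u v) (fun u => t u - dl x u + dl y u)) :
    Sol k W m t := by
  obtain ⟨o, h0, h1, h2⟩ := h
  refine ⟨fun u v => o u v + dl x u * dl y v, ?_, ?_, ?_⟩
  · intro u hu v hv
    exact add_nonneg (h0 u hu v hv) (mul_nonneg (dl_nonneg _ _) (dl_nonneg _ _))
  · intro u hu v hv huv
    have := h1 u hu v hv huv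
    unfold Ed at this
    linarith
  · intro u hu
    convert h2 u hu using 1
    simp only [sum_sub_distrib, sum_add_distrib, ← mul_sum, ← sum_mul, sum_dl, hx, hy, if_true]
    ring

theorem sol_unorient {k : ℤ} {W : Finset V} {m : V → V → ℤ} {t : V → ℤ} {y z : V} (hy : y ∈ W)
    (hz : z ∈ W) (hyz : y ≠ z) (hm : 0 ≤ m y z)
    (h : Sol k W (fun u v => m u v + Ed y z u v) t) :
    Sol k W m (fun u => t u - dl y u + dl z u) ∨ Sol k W m (fun u => t u - dl z u + dl y u) := by
  obtain ⟨o, h0, h1, h2⟩ := h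
  have key : ∀ p q : V, p ∈ W → q ∈ W → p ≠ q → 1 ≤ o p q → (∀ u v, Ed p q u v = Ed y z u v) →
      Sol k W m (fun u => t u - dl p u + dl q u) := by
    intro p q hp hq hpq ho hE
    refine ⟨fun u v => o u v - dl p u * dl q v, ?_, ?_, ?_⟩
    · intro u hu v hv
      have := h0 u hu v hv
      unfold dl
      by_cases e1 : u = p <;> by_cases e2 : v = q <;> simp [*]
    · intro u hu v hv huv
      have := h1 u hu v hv huv
      simp only [← hE u v] at this
      unfold Ed at this
      linarith
    · intro u hu
      convert h2 u hu using 1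
      simp only [sum_sub_distrib, ← mul_sum, ← sum_mul, sum_dl, hp, hq, if_true]
      ring
  have h3 := h1 y hy z hz hyz
  have h4 : Ed y z y z = 1 := by simp [Ed, dl, hyz]
  rcases le_or_gt 1 (o y z) with h5 | h5
  · exact Or.inl (key y z hy hz hyz h5 fun _ _ => rfl)
  · right
    refine key z y hz hy hyz.symm (by simp only [h4] at h3; omega) fun u v => ?_
    unfold Ed; ring

theorem sol_lift {k : ℤ} {W : Finset V} {m : V → V → ℤ} {t : V → ℤ} {x y z : V} (hx : x ∈ W)
    (hy : y ∈ W) (hz : z ∈ W) (hyz : y ≠ z) (hm : 0 ≤ m y z - Ed x y y z - Ed x z y z)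
    (h : Sol k W (fun u v => m u v - Ed x y u v - Ed x z u v + Ed y z u v) t) :
    Sol k W m t := by
  rcases sol_unorient (m := fun u v => m u v - Ed x y u v - Ed x z u v) hy hz hyz hm h with h | h
  · -- y → x → z
    apply sol_orient hy hx
    apply sol_orient hx hz
    convert h using 2
    · funext v; unfold Ed; ring
    · ring
  · apply sol_orient hz hx
    apply sol_orient hx hy
    convert h using 2
    · funext v; unfold Ed; ring
    · ring

theorem sol_double {k : ℤ} {W : Finset V} {m : V → V → ℤ} {t : V → ℤ} {x y : V} (hx : x ∈ W)
    (hy : y ∈ W) (h : Sol k W (fun u v => m u v - 2 * Ed x y u v) t) : Sol k W m t := by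
  apply sol_orient hx hy
  apply sol_orient hy hx
  convert h using 2
  · funext v; unfold Ed; ring
  · ring

/-- orient an edge `x → y`, with new certificate. -/
def Cfg.ori (c : Cfg V) (x y : V) (a' b' : V → ℤ) : Cfg V :=
  ⟨fun u v => c.m u v - Ed x y u v, fun u => c.t u - dl x u + dl y u, a', b'⟩

theorem ori_base {k : ℤ} {W : Finset V} {c : Cfg V} (hb : Base k W c) {x y : V} (hx : x ∈ W)
    (hy : y ∈ W) (hxy : x ≠ y) (hm : 1 ≤ c.m x y) {a' b' : V → ℤ} (ha : ∀ v, 0 ≤ a' v)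
    (hb' : ∀ v, 0 ≤ b' v) (hs : SS k (∑ v ∈ W, a' v) (∑ v ∈ W, b' v)) :
    Base k W (c.ori x y a' b') where
  sym u v := by simp only [Cfg.ori]; rw [hb.sym, Ed_symm]
  nn u v := by
    have := Ed_le hb.sym hb.nn hxy hm u v
    simpa only [Cfg.ori, one_mul] using this
  an := ha
  bn := hb'
  tot := by
    simp only [Cfg.ori, sum_sub_distrib, sum_add_distrib, sum_dl, hx, hy, if_true]
    have := hb.tot
    simpa using this
  par A hA := by
    simp only [Cfg.ori, sum_sub_distrib, sum_add_distrib, sum_dl]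
    rw [dd_sub, dd_Ed hx hy]
    have := hb.par A hA
    by_cases h1 : x ∈ A <;> by_cases h2 : y ∈ A <;> simp only [h1, h2, if_true, if_false] <;> simp <;> omega
  ss := hs

theorem ori_D {W A : Finset V} (c : Cfg V) {x y : V} (hx : x ∈ W) (hy : y ∈ W) (a' b' : V → ℤ) :
    (c.ori x y a' b').D W A = dd W A c.m - (if (x ∈ A ↔ y ∈ A) then 0 else 1) +
      ∑ v ∈ A, a' v + ∑ v ∈ A, b' v := by
  simp only [Cfg.D, Cfg.ori]
  rw [dd_sub, dd_Ed hx hy]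

theorem ori_ta {A : Finset V} (c : Cfg V) {x y : V} (a' b' : V → ℤ) :
    (c.ori x y a' b').ta A = ∑ v ∈ A, c.t v - (if x ∈ A then 1 else 0) +
      (if y ∈ A then 1 else 0) + ∑ v ∈ A, b' v - ∑ v ∈ A, a' v := by
  simp only [Cfg.ta, Cfg.ori]
  simp only [sum_sub_distrib, sum_add_distrib, sum_dl]

theorem ori_Mt {W : Finset V} (c : Cfg V) {x y : V} (hx : x ∈ W) (hy : y ∈ W) (a' b' : V → ℤ) :
    Mt W (c.ori x y a' b').m = Mt W c.m - 2 := by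
  simp only [Cfg.ori]; rw [Mt_sub, Mt_Ed hx hy]

end PartA2

section PartA3
open Finset
set_option linter.unusedSectionVars false
variable {V : Type} [DecidableEq V]

def MainP (V : Type) [DecidableEq V] (k : ℤ) (n : ℕ) : Prop :=
  ∀ (W : Finset V) (c : Cfg V), W.card = n → Base k W c → W.Nonempty →
    (∀ A ⊆ W, A.Nonempty → A ≠ W → Ok k W c A) → Sol k W c.m c.t

structure EHyp (k : ℤ) (W : Finset V) (c : Cfg V) (x : V) : Prop where
  base : Base k W c
  xW : x ∈ W
  two : 2 ≤ W.card
  bal : 2 * k ∣ c.t x + c.b x - c.a x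
  v5 : c.a x + c.b x ≤ dd W {x} c.m
  ok : ∀ A ⊆ W, (A.erase x).Nonempty → insert x A ≠ W → Ok k W c A

def EP (V : Type) [DecidableEq V] (k : ℤ) (n : ℕ) : Prop :=
  ∀ (W : Finset V) (c : Cfg V) (x : V), W.card = n → EHyp k W c x → Sol k W c.m c.t

theorem card_cW {W A : Finset V} {a0 : V} (ha : a0 ∈ A) (hA : A ⊆ W) :
    (cW W A a0).card + A.card = W.card + 1 := by
  unfold cW
  rw [card_insert_of_notMem (fun h => (mem_sdiff.mp h).2 ha), card_sdiff_of_subset hA]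
  have := card_le_card hA
  omega

theorem exists_ne_of_two_le {A : Finset V} (h : 2 ≤ A.card) (x : V) : ∃ y ∈ A, y ≠ x :=
  exists_mem_ne (by omega) x

theorem E_tight_out {k : ℤ} (hk : 0 < k) {n : ℕ} (hM : ∀ n' < n, MainP V k n')
    (hE : ∀ n' < n, EP V k n') {W : Finset V} {c : Cfg V} {x : V} (hn : W.card = n)
    (h : EHyp k W c x) {A : Finset V} (hA : A ⊆ W) (hx : x ∉ A) (h2 : 2 ≤ A.card)
    (hne : insert x A ≠ W) (htight : c.D W A = 2 * k - 2 + nu k (c.ta A)) :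
    Sol k W c.m c.t := by
  obtain ⟨a0, ha⟩ : A.Nonempty := card_pos.mp (by omega)
  have hcc := card_cW ha hA
  have hxc : x ∈ cW W A a0 := mem_insert_of_mem (mem_sdiff.mpr ⟨h.xW, hx⟩)
  have hxa : x ≠ a0 := by rintro rfl; exact hx ha
  have hpx : pre A a0 {x} = {x} := by simp [pre, Fb, hxa]
  refine sol_of_tight hk ha hA h.base htight ?_ ?_
  · refine hE _ (by omega) _ _ x rfl ⟨ctr_base ha hA h.base, hxc, ?_, ?_, ?_, ?_⟩
    · have : ({x, a0} : Finset V) ⊆ cW W A a0 := by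
        intro v hv; simp at hv; rcases hv with rfl | rfl
        exacts [hxc, mem_insert_self _ _]
      have := card_le_card this
      rwa [card_pair hxa] at this
    · simpa [Cfg.ctr, Fb, hxa] using h.bal
    · rw [ctr_dd c ha hA (singleton_subset_iff.mpr hxc), hpx]
      simpa [Cfg.ctr, Fb, hxa] using h.v5
    · intro B hB h3 h4
      refine ctr_ok ha hA hB (h.ok _ (pre_sub ha hA hB) ?_ ?_)
      · obtain ⟨v, hv⟩ := pre_nonempty ha ((erase_subset x B).trans hB) h3
        refine ⟨v, mem_erase.mpr ?_⟩
        rw [mem_pre ha ((erase_subset x B).trans hB)] at hv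
        rw [mem_pre ha hB]
        simp only [mem_erase] at hv
        rcases hv with ⟨hv1, hv2, hv3⟩ | ⟨hv1, hv2, hv3⟩
        · exact ⟨by rintro rfl; exact hx hv1, Or.inl ⟨hv1, hv3⟩⟩
        · exact ⟨hv2, Or.inr ⟨hv1, hv3⟩⟩
      · intro h5
        apply h4
        apply pre_inj ha hA (insert_subset hxc hB)
        rw [← h5, pre, biUnion_insert]
        have : Fb A a0 x = {x} := by simp [Fb, hxa]
        rw [this]; rfl
  · intro c' hc' hb' hD
    have hlt : A.card < W.card := by
      have := card_le_card (insert_subset h.xW hA)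
      rw [card_insert_of_notMem hx] at this; omega
    refine hM _ (by omega) _ _ rfl hb' ⟨a0, ha⟩ ?_
    intro B hB h3 h4
    have h5 := h.ok B (hB.trans hA) (by rwa [erase_eq_of_notMem (fun h => hx (hB h))]) ?_
    · unfold Ok at *; rw [(hD B hB).1, (hD B hB).2]; exact h5
    · intro h6
      have := card_le_card (insert_subset h.xW hA)
      rw [card_insert_of_notMem hx] at this
      rw [← h6, card_insert_of_notMem (fun h => hx (hB h))] at this
      exact h4 (eq_of_subset_of_card_le hB (by omega))

theorem D_split {W A : Finset V} {c : Cfg V} (hs : ∀ u v, c.m u v = c.m v u) (hA : A ⊆ W) {x : V}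
    (hx : x ∈ A) : c.D W A = c.D W (A.erase x) + c.D W {x} - 2 * dd A {x} c.m := by
  have h1 : A = {x} ∪ A.erase x := by
    ext v; simp only [mem_union, mem_singleton, mem_erase]
    constructor
    · intro h; by_cases h' : v = x <;> simp [*]
    · rintro (rfl | h)
      exacts [hx, h.2]
  have hd : Disjoint {x} (A.erase x) := by simp
  have h2 := dd_union (m := c.m) hs (singleton_subset_iff.mpr (hA hx))
    ((erase_subset x A).trans hA) hd
  rw [← h1] at h2
  have h3 : ∀ f : V → ℤ, ∑ v ∈ A, f v = f x + ∑ v ∈ A.erase x, f v :=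
    fun f => (add_sum_erase _ _ hx).symm
  have h4 : dd A {x} c.m = ∑ u ∈ {x}, ∑ v ∈ A.erase x, c.m u v := by
    rw [dd, sdiff_singleton_eq_erase]
  unfold Cfg.D
  rw [h2, h3, h3, h4]
  simp only [sum_singleton]
  ring

theorem ta_split {A : Finset V} {c : Cfg V} {x : V}
    (hx : x ∈ A) : c.ta A = c.ta (A.erase x) + (c.t x + c.b x - c.a x) := by
  have h3 : ∀ f : V → ℤ, ∑ v ∈ A, f v = f x + ∑ v ∈ A.erase x, f v :=
    fun f => (add_sum_erase _ _ hx).symm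
  unfold Cfg.ta
  rw [h3, h3, h3]; ring

theorem E_tight_in {k : ℤ} (hk : 0 < k) {n : ℕ} (hM : ∀ n' < n, MainP V k n')
    (hE : ∀ n' < n, EP V k n') {W : Finset V} {c : Cfg V} {x : V} (hn : W.card = n)
    (h : EHyp k W c x) {A : Finset V} (hA : A ⊆ W) (hx : x ∈ A) (h2 : 2 ≤ A.card)
    (hne : A ≠ W) (htight : c.D W A = 2 * k - 2 + nu k (c.ta A)) :
    Sol k W c.m c.t := by
  have hcc := card_cW hx hA
  have hlt : A.card < W.card := card_lt_card (hA.ssubset_of_ne hne)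
  obtain ⟨y, hyA, hyx⟩ := exists_ne_of_two_le h2 x
  refine sol_of_tight hk hx hA h.base htight ?_ ?_
  · refine hM _ (by omega) _ _ rfl (ctr_base hx hA h.base) ⟨x, mem_insert_self _ _⟩ ?_
    intro B hB h3 h4
    refine ctr_ok hx hA hB (h.ok _ (pre_sub hx hA hB) ?_ ?_)
    · by_cases hxB : x ∈ B
      · exact ⟨y, mem_erase.mpr ⟨hyx, by rw [mem_pre hx hB]; tauto⟩⟩
      · obtain ⟨v, hv⟩ := h3
        refine ⟨v, mem_erase.mpr ⟨by rintro rfl; exact hxB hv, ?_⟩⟩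
        have h5 := hB hv
        have : v ≠ x := by rintro rfl; exact hxB hv
        simp [cW, this] at h5
        rw [mem_pre hx hB]; tauto
    · intro h5
      by_cases hxB : x ∈ B
      · rw [insert_eq_of_mem (by rw [mem_pre hx hB]; tauto)] at h5
        exact h4 (pre_inj hx hA hB h5)
      · have : y ∈ insert x (pre A x B) := by rw [h5]; exact hA hyA
        rw [mem_insert, mem_pre hx hB] at this
        tauto
  · intro c' hc' hb' hD
    have hbal : c'.ta {x} = c.ta {x} := (hD _ (singleton_subset_iff.mpr hx)).2
    simp only [Cfg.ta, sum_singleton] at hbal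
    refine hE _ (by omega) _ _ x rfl ⟨hb', hx, h2, ?_, ?_, ?_⟩
    · rw [hbal]; exact h.bal
    · have h5 := (hD _ (singleton_subset_iff.mpr hx)).1
      have h6 := D_split h.base.sym hA hx
      have h7 := h.ok (A.erase x) ((erase_subset x A).trans hA)
        ⟨y, by simp [hyA, hyx]⟩ (by rwa [insert_erase hx])
      have h8 : nu k (c.ta A) = nu k (c.ta (A.erase x)) := by
        apply nu_congr hk
        rw [ta_split hx]
        simpa using h.bal
      unfold Ok at h7
      have h9 : c'.D A {x} = dd A {x} c'.m + c'.a x + c'.b x := by simp [Cfg.D]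
      rw [hc'] at h9 ⊢
      omega
    · intro B hB h3 h4
      have h5 := h.ok B (hB.trans hA) h3 ?_
      · unfold Ok at *; rw [(hD B hB).1, (hD B hB).2]; exact h5
      · intro h6
        have := card_le_card (insert_subset hx hB)
        rw [h6] at this; omega

theorem E_iso {k : ℤ} {n : ℕ} (hM : ∀ n' < n, MainP V k n')
    {W : Finset V} {c : Cfg V} {x : V} (hn : W.card = n)
    (h : EHyp k W c x) (h0 : dd W {x} c.m = 0) :
    Sol k W c.m c.t := by
  have hb := h.base
  have ha0 := hb.an x
  have hb0 := hb.bn x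
  have hv := h.v5
  have hax : c.a x = 0 := by omega
  have hbx : c.b x = 0 := by omega
  have htx : 2 * k ∣ c.t x := by
    have := h.bal
    rwa [hax, hbx, add_zero, sub_zero] at this
  have hm0 : ∀ v ∈ W.erase x, c.m x v = 0 := by
    intro v hv
    simp only [dd, sum_singleton, sdiff_singleton_eq_erase] at h0
    exact (sum_eq_zero_iff_of_nonneg fun v _ => hb.nn x v).mp h0 v hv
  have hcard := card_erase_of_mem h.xW
  have htwo := h.two
  have hsub := erase_subset x W
  have hdd : ∀ A ⊆ W.erase x, dd W A c.m = dd (W.erase x) A c.m := by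
    intro A hA
    rw [dd_restrict hsub hA]
    rw [sum_eq_zero, add_zero]
    intro u hu
    apply sum_eq_zero
    intro v hv
    have : v = x := by
      simp only [mem_sdiff, mem_erase] at hv; tauto
    rw [this, hb.sym]
    exact hm0 u (hA hu)
  have hbase : Base k (W.erase x) c := by
    refine ⟨hb.sym, hb.nn, hb.an, hb.bn, ?_, ?_, ?_⟩
    · have h1 := hb.tot
      rw [← add_sum_erase _ _ h.xW] at h1
      exact (dvd_add_right htx).mp h1
    · intro A hA
      rw [← hdd A hA]; exact hb.par A (hA.trans hsub)
    · have h1 := hb.ss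
      rwa [← add_sum_erase _ _ h.xW, ← add_sum_erase _ c.b h.xW, hax, hbx, zero_add,
        zero_add] at h1
  obtain ⟨o, h1, h2, h3⟩ := hM _ (by omega) (W.erase x) c rfl hbase (card_pos.mp (by omega)) (by
    intro A hA h3 h4
    have hxA : x ∉ A := fun h => by simpa using hA h
    have h5 := h.ok A (hA.trans hsub) (by rwa [erase_eq_of_notMem hxA])
      (by intro h6; apply h4; rw [← h6, erase_insert hxA])
    unfold Ok Cfg.D at *
    rwa [← hdd A hA])
  refine ⟨fun u v => if u = x ∨ v = x then 0 else o u v, ?_, ?_, ?_⟩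
  · intro u hu v hv
    by_cases h4 : u = x ∨ v = x
    · simp [h4]
    · simp only [h4, if_false]
      push Not at h4
      exact h1 u (by simp [*]) v (by simp [*])
  · intro u hu v hv huv
    by_cases h4 : u = x
    · subst h4; simp; exact (hm0 v (mem_erase.mpr ⟨huv.symm, by assumption⟩)).symm
    · by_cases h5 : v = x
      · subst h5; simp; rw [hb.sym]; exact (hm0 u (by simp [hu, huv])).symm
      · simp only [h4, h5, or_self, if_false]
        exact h2 u (by simp [*]) v (by simp [*]) huv
  · intro u hu
    by_cases h4 : u = x
    · subst h4; simpa using htx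
    · have := h3 u (by simp [*])
      convert this using 2
      rw [← add_sum_erase _ _ h.xW]
      simp only [h4, or_true, true_or, if_true, sub_self, zero_add]
      refine sum_congr rfl fun v hv => ?_
      simp [(mem_erase.mp hv).1]

set_option maxHeartbeats 1000000 in
theorem E_step {k : ℤ} (hk : 0 < k) {n : ℕ} (hM : ∀ n' < n, MainP V k n')
    (hE : ∀ n' < n, EP V k n') : EP V k n := by
  intro W c x hn h
  induction hN : (Mt W c.m).toNat using Nat.strong_induction_on generalizing c with
  | _ N ih =>
  subst hN
  have hb := h.base
  by_cases h0 : dd W {x} c.m = 0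
  · exact E_iso hM hn h h0
  by_cases hT1 : ∃ A ⊆ W, x ∉ A ∧ 2 ≤ A.card ∧ insert x A ≠ W ∧
      c.D W A = 2 * k - 2 + nu k (c.ta A)
  · obtain ⟨A, h1, h2, h3, h4, h5⟩ := hT1
    exact E_tight_out hk hM hE hn h h1 h2 h3 h4 h5
  by_cases hT2 : ∃ A ⊆ W, x ∈ A ∧ 2 ≤ A.card ∧ A ≠ W ∧
      c.D W A = 2 * k - 2 + nu k (c.ta A)
  · obtain ⟨A, h1, h2, h3, h4, h5⟩ := hT2
    exact E_tight_in hk hM hE hn h h1 h2 h3 h4 h5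
  have hgap : ∀ A ⊆ W, (A.erase x).Nonempty → insert x A ≠ W → 2 ≤ A.card →
      2 * k + nu k (c.ta A) ≤ c.D W A := by
    intro A hA h1 h2 h3
    have h4 := h.ok A hA h1 h2
    have h5 := gap_even hk hb hA
    unfold Ok at h4
    have h6 : c.D W A ≠ 2 * k - 2 + nu k (c.ta A) := by
      intro h6
      by_cases hx : x ∈ A
      · exact hT2 ⟨A, hA, hx, h3, by rwa [insert_eq_of_mem hx] at h2, h6⟩
      · exact hT1 ⟨A, hA, hx, h3, h2, h6⟩
    omega
  have hgapx : ∀ A ⊆ W, (A.erase x).Nonempty → insert x A ≠ W → x ∈ A →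
      2 * k + nu k (c.ta A) ≤ c.D W A := by
    intro A hA h1 h2 h3
    refine hgap A hA h1 h2 ?_
    have := card_pos.mpr h1
    rw [card_erase_of_mem h3] at this; omega
  have hddx : dd W {x} c.m = ∑ v ∈ W.erase x, c.m x v := by
    simp only [dd, sum_singleton, sdiff_singleton_eq_erase]
  obtain ⟨y, hy, hmy⟩ : ∃ y ∈ W.erase x, c.m x y ≠ 0 := by
    by_contra hcon
    push Not at hcon
    exact h0 (by rw [hddx]; exact sum_eq_zero hcon)
  obtain ⟨hyx, hyW⟩ := mem_erase.mp hy
  have hxW := h.xW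
  have hmy1 : 1 ≤ c.m x y := by have := hb.nn x y; omega
  have hmy1' : 1 ≤ c.m y x := by rw [hb.sym]; exact hmy1
  have hMt : ∀ c' : Cfg V, Base k W c' → Mt W c'.m ≤ Mt W c.m - 2 →
      (Mt W c'.m).toNat < (Mt W c.m).toNat := by
    intro c' hb' h1
    have := Mt_nonneg (W := W) hb'.nn
    omega
  have hxyx : ¬ (x ∈ ({x} : Finset V) ↔ y ∈ ({x} : Finset V)) := by simp [hyx]
  have hyxx : ¬ (y ∈ ({x} : Finset V) ↔ x ∈ ({x} : Finset V)) := by simp [hyx]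
  by_cases hax : 1 ≤ c.a x
  · -- use an arc root → x
    let a' : V → ℤ := fun u => c.a u - dl x u + dl y u
    have hsa : ∀ A : Finset V, ∑ v ∈ A, a' v = ∑ v ∈ A, c.a v - (if x ∈ A then 1 else 0) +
        (if y ∈ A then 1 else 0) := by
      intro A; simp only [a', sum_sub_distrib, sum_add_distrib, sum_dl]
    have hb' : Base k W (c.ori x y a' c.b) := by
      refine ori_base hb hxW hyW hyx.symm hmy1 ?_ hb.bn ?_
      · intro v
        have h1 := hb.an v
        have h2 := dl_nonneg y v
        simp only [a']
        by_cases hv : v = x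
        · subst hv; simp only [dl, if_true] at *; omega
        · simp only [dl, hv, if_false] at *; omega
      · rw [hsa]; simp only [hxW, hyW, if_true]; simpa using hb.ss
    refine sol_orient hxW hyW (ih _ (hMt _ hb' (le_of_eq (ori_Mt c hxW hyW _ _))) _ ?_ rfl)
    refine ⟨hb', hxW, h.two, ?_, ?_, ?_⟩
    · have := h.bal
      convert this using 1
      simp [Cfg.ori, a', dl, hyx.symm]; ring
    · have h1 := h.v5
      simp only [Cfg.ori]
      rw [dd_sub, dd_Ed hxW hyW, if_neg hxyx]
      simp [a', dl, hyx.symm]; omega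
    · intro A hA h1 h2
      have h3 := h.ok A hA h1 h2
      have h4 := hgapx A hA h1 h2
      unfold Ok at *
      rw [ori_D c hxW hyW, ori_ta, hsa]
      unfold Cfg.D at *
      have e : ∑ v ∈ A, c.t v - (if x ∈ A then 1 else 0) + (if y ∈ A then 1 else 0) + ∑ v ∈ A, c.b v
        - (∑ v ∈ A, c.a v - (if x ∈ A then 1 else 0) + (if y ∈ A then 1 else 0)) = c.ta A := by
        unfold Cfg.ta; ring
      rw [e]
      by_cases hx : x ∈ A <;> by_cases hy : y ∈ A <;> simp only [hx, hy, if_true, if_false] at h3 h4 ⊢ <;>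
        simp at h3 h4 ⊢ <;> omega
  by_cases hbx : 1 ≤ c.b x
  · -- use an arc x → root
    let b' : V → ℤ := fun u => c.b u - dl x u + dl y u
    have hsb : ∀ A : Finset V, ∑ v ∈ A, b' v = ∑ v ∈ A, c.b v - (if x ∈ A then 1 else 0) +
        (if y ∈ A then 1 else 0) := by
      intro A; simp only [b', sum_sub_distrib, sum_add_distrib, sum_dl]
    have hb' : Base k W (c.ori y x c.a b') := by
      refine ori_base hb hyW hxW hyx hmy1' hb.an ?_ ?_
      · intro v
        have h1 := hb.bn v
        have h2 := dl_nonneg y v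
        simp only [b']
        by_cases hv : v = x
        · subst hv; simp only [dl, if_true] at *; omega
        · simp only [dl, hv, if_false] at *; omega
      · rw [hsb]; simp only [hxW, hyW, if_true]; simpa using hb.ss
    refine sol_orient hyW hxW (ih _ (hMt _ hb' (le_of_eq (ori_Mt c hyW hxW _ _))) _ ?_ rfl)
    refine ⟨hb', hxW, h.two, ?_, ?_, ?_⟩
    · have := h.bal
      convert this using 1
      simp [Cfg.ori, b', dl, hyx.symm]
    · have h1 := h.v5
      simp only [Cfg.ori]
      rw [dd_sub, dd_Ed hyW hxW, if_neg hyxx]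
      simp [b', dl, hyx.symm]; omega
    · intro A hA h1 h2
      have h3 := h.ok A hA h1 h2
      have h4 := hgapx A hA h1 h2
      unfold Ok at *
      rw [ori_D c hyW hxW, ori_ta, hsb]
      unfold Cfg.D at *
      have e : ∑ v ∈ A, c.t v - (if y ∈ A then 1 else 0) + (if x ∈ A then 1 else 0) + (∑ v ∈ A, c.b v
        - (if x ∈ A then 1 else 0) + (if y ∈ A then 1 else 0)) - ∑ v ∈ A, c.a v = c.ta A := by
        unfold Cfg.ta; ring
      rw [e]
      by_cases hx : x ∈ A <;> by_cases hy : y ∈ A <;> simp only [hx, hy, if_true, if_false] at h3 h4 ⊢ <;>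
        simp at h3 h4 ⊢ <;> omega
  have hax0 : c.a x = 0 := by have := hb.an x; omega
  have hbx0 : c.b x = 0 := by have := hb.bn x; omega
  by_cases hz : ∃ z ∈ W, z ≠ x ∧ z ≠ y ∧ c.m x z ≠ 0
  · -- lift
    obtain ⟨z, hzW, hzx, hzy, hmz⟩ := hz
    have hmz1 : 1 ≤ c.m x z := by have := hb.nn x z; omega
    let c' : Cfg V := ⟨fun u v => c.m u v - Ed x y u v - Ed x z u v + Ed y z u v, c.t, c.a, c.b⟩
    have hdd' : ∀ A : Finset V, dd W A c'.m = dd W A c.m - (if (x ∈ A ↔ y ∈ A) then 0 else 1)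
        - (if (x ∈ A ↔ z ∈ A) then 0 else 1) + (if (y ∈ A ↔ z ∈ A) then 0 else 1) := by
      intro A
      simp only [c']
      rw [dd_add, dd_sub, dd_sub, dd_Ed hxW hyW, dd_Ed hxW hzW, dd_Ed hyW hzW]
    have hnn1 : ∀ u v, 0 ≤ c.m u v - Ed x y u v - Ed x z u v := by
      intro u v
      have h1 := Ed_le hb.sym hb.nn hyx.symm hmy1 u v
      have h2 := Ed_le (m := fun u v => c.m u v - Ed x y u v) (r := 1) (x := x) (y := z)
        (fun u v => by rw [hb.sym, Ed_symm])
        (fun u v => by have := Ed_le hb.sym hb.nn hyx.symm hmy1 u v; simpa using this)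
        hzx.symm (by
          have : Ed x y x z = 0 := by simp [Ed, dl, hzy, hyx.symm]
          rw [this]; omega) u v
      simpa using h2
    have hb' : Base k W c' := by
      refine ⟨?_, ?_, hb.an, hb.bn, hb.tot, ?_, hb.ss⟩
      · intro u v
        simp only [c']
        rw [hb.sym, Ed_symm, Ed_symm x z, Ed_symm y z]
      · intro u v
        exact add_nonneg (hnn1 u v) (Ed_nonneg _ _ _ _)
      · intro A hA
        rw [hdd']
        have := hb.par A hA
        simp only [c']
        by_cases hx : x ∈ A <;> by_cases hy : y ∈ A <;> by_cases hz : z ∈ A <;>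
          simp [hx, hy, hz] <;> omega
    refine sol_lift hxW hyW hzW hzy.symm (hnn1 y z) (ih _ (hMt _ hb' ?_) c' ?_ rfl)
    · simp only [c']
      rw [Mt_add, Mt_sub, Mt_sub, Mt_Ed hxW hyW, Mt_Ed hxW hzW, Mt_Ed hyW hzW]
      omega
    refine ⟨hb', hxW, h.two, h.bal, ?_, ?_⟩
    · have : 0 ≤ dd W {x} c'.m := sum_nonneg fun _ _ => sum_nonneg fun _ _ => hb'.nn _ _
      simp only [c'] at this ⊢
      omega
    · intro A hA h1 h2
      have h3 := h.ok A hA h1 h2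
      have h4 := hgapx A hA h1 h2
      have h5 := hgap A hA h1 h2
      unfold Ok at *
      have e : c'.ta A = c.ta A := rfl
      rw [e]
      unfold Cfg.D at *
      rw [hdd']
      have h6 : y ∈ A → z ∈ A → 2 ≤ A.card := by
        intro h7 h8
        have : ({y, z} : Finset V) ⊆ A := by
          intro v hv; simp at hv; rcases hv with rfl | rfl <;> assumption
        have := card_le_card this
        rwa [card_pair hzy.symm] at this
      simp only [c']
      by_cases hx : x ∈ A <;> by_cases hy : y ∈ A <;> by_cases hz : z ∈ A <;>
        simp only [hx, hy, hz, true_implies] at h3 h4 h5 h6 ⊢ <;> simp at h3 h4 h5 h6 ⊢ <;> omega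
  · -- all edges at `x` go to `y`
    push Not at hz
    have hxy : dd W {x} c.m = c.m x y := by
      rw [hddx, sum_eq_single_of_mem y hy]
      intro v hv hvy
      exact hz v (mem_erase.mp hv).2 (mem_erase.mp hv).1 hvy
    have htx : 2 * k ∣ c.t x := by
      have := h.bal
      rwa [hax0, hbx0, add_zero, sub_zero] at this
    have h2m : 2 ≤ c.m x y := by
      have h1 := hb.par {x} (singleton_subset_iff.mpr hxW)
      rw [hxy, sum_singleton] at h1
      have h2 : (2 : ℤ) ∣ c.t x := (Dvd.intro _ rfl).trans htx
      omega
    let c' : Cfg V := ⟨fun u v => c.m u v - 2 * Ed x y u v, c.t, c.a, c.b⟩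
    have e2 : (fun u v => c.m u v - 2 * Ed x y u v) = 
        fun u v => (fun u v => c.m u v - Ed x y u v) u v - Ed x y u v := by
      funext u v; ring
    have hdd' : ∀ A : Finset V, dd W A c'.m
        = dd W A c.m - 2 * (if (x ∈ A ↔ y ∈ A) then 0 else 1) := by
      intro A
      simp only [c']
      rw [e2, dd_sub, dd_sub, dd_Ed hxW hyW]; ring
    have hb' : Base k W c' := by
      refine ⟨?_, ?_, hb.an, hb.bn, hb.tot, ?_, hb.ss⟩
      · intro u v
        simp only [c']
        rw [hb.sym, Ed_symm]
      · exact Ed_le hb.sym hb.nn hyx.symm h2m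
      · intro A hA
        rw [hdd']
        have := hb.par A hA
        simp only [c']
        split_ifs <;> omega
    refine sol_double hxW hyW (ih _ (hMt _ hb' ?_) c' ?_ rfl)
    · simp only [c']
      rw [e2, Mt_sub, Mt_sub, Mt_Ed hxW hyW]
      omega
    refine ⟨hb', hxW, h.two, h.bal, ?_, ?_⟩
    · have : 0 ≤ dd W {x} c'.m := sum_nonneg fun _ _ => sum_nonneg fun _ _ => hb'.nn _ _
      simp only [c'] at this ⊢
      omega
    · intro A hA h1 h2
      have h3 := h.ok A hA h1 h2
      have h4 := hgapx A hA h1 h2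
      have h5 : x ∉ A → y ∈ A → 2 * k + nu k (c.ta A) ≤ c.D W A := by
        intro hxA hyA
        -- compare with `insert x A`
        have h6 := hgapx (insert x A) (insert_subset hxW hA)
          ⟨y, by simp [hyA, hyx]⟩ (by simpa using h2) (mem_insert_self _ _)
        have h7 := D_split hb.sym (insert_subset hxW hA) (mem_insert_self x A)
        have h8 := ta_split (c := c) (mem_insert_self x A)
        rw [erase_insert hxA] at h7 h8
        have h9 : nu k (c.ta (insert x A)) = nu k (c.ta A) := by
          apply nu_congr hk
          rw [h8]; simpa using h.bal
        have h10 : c.D W {x} = c.m x y := by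
          unfold Cfg.D; rw [hxy]; simp [hax0, hbx0]
        have h11 : c.m x y ≤ dd (insert x A) {x} c.m := by
          simp only [dd, sum_singleton]
          refine single_le_sum (f := fun v => c.m x v) (fun v _ => hb.nn x v) ?_
          simp [hyA, hyx]
        omega
      unfold Ok at *
      have e : c'.ta A = c.ta A := rfl
      rw [e]
      unfold Cfg.D at *
      rw [hdd']
      simp only [c']
      by_cases hx : x ∈ A <;> by_cases hy : y ∈ A <;>
        simp only [hx, hy, true_implies] at h3 h4 h5 ⊢ <;> simp at h3 h4 h5 ⊢ <;> omega

end PartA3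

section PartA4
open Finset
set_option linter.unusedSectionVars false
variable {V : Type} [DecidableEq V]

structure MHyp (k : ℤ) (W : Finset V) (c : Cfg V) : Prop where
  base : Base k W c
  two : 2 ≤ W.card
  ok : ∀ A ⊆ W, A.Nonempty → A ≠ W → Ok k W c A

theorem M_tight {k : ℤ} (hk : 0 < k) {n : ℕ} (hM : ∀ n' < n, MainP V k n')
    {W : Finset V} {c : Cfg V} (hn : W.card = n)
    (h : MHyp k W c) {A : Finset V} (hA : A ⊆ W) (h2 : 2 ≤ A.card)
    (hne : A ≠ W) (htight : c.D W A = 2 * k - 2 + nu k (c.ta A)) :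
    Sol k W c.m c.t := by
  obtain ⟨a0, ha⟩ : A.Nonempty := card_pos.mp (by omega)
  have hcc := card_cW ha hA
  have hlt : A.card < W.card := card_lt_card (hA.ssubset_of_ne hne)
  refine sol_of_tight hk ha hA h.base htight ?_ ?_
  · refine hM _ (by omega) _ _ rfl (ctr_base ha hA h.base) ⟨a0, mem_insert_self _ _⟩ ?_
    intro B hB h3 h4
    exact ctr_ok ha hA hB (h.ok _ (pre_sub ha hA hB) (pre_nonempty ha hB h3)
      (fun h5 => h4 (pre_inj ha hA hB h5)))
  · intro c' hc' hb' hD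
    refine hM _ (by omega) _ _ rfl hb' ⟨a0, ha⟩ ?_
    intro B hB h3 h4
    have h5 := h.ok B (hB.trans hA) h3 (by
      rintro rfl; exact hne (Subset.antisymm hA hB))
    unfold Ok at *; rw [(hD B hB).1, (hD B hB).2]; exact h5

theorem M_gap {k : ℤ} (hk : 0 < k) {n : ℕ} (hM : ∀ n' < n, MainP V k n')
    {W : Finset V} {c : Cfg V} (hn : W.card = n) (h : MHyp k W c) :
    Sol k W c.m c.t ∨ ∀ A ⊆ W, 2 ≤ A.card → A ≠ W → 2 * k + nu k (c.ta A) ≤ c.D W A := by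
  by_cases hT : ∃ A ⊆ W, 2 ≤ A.card ∧ A ≠ W ∧ c.D W A = 2 * k - 2 + nu k (c.ta A)
  · obtain ⟨A, h1, h2, h3, h4⟩ := hT
    exact Or.inl (M_tight hk hM hn h h1 h2 h3 h4)
  · right
    intro A hA h2 h3
    have h4 := h.ok A hA (card_pos.mp (by omega)) h3
    have h5 := gap_even hk h.base hA
    unfold Ok at h4
    have h6 : c.D W A ≠ 2 * k - 2 + nu k (c.ta A) := fun h6 => hT ⟨A, hA, h2, h3, h6⟩
    omega

def OG (k : ℤ) (W : Finset V) (c : Cfg V) (x : V) : Prop :=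
  2 * k - 2 + nu k (c.ta {x} - 1) ≤ c.D W {x} - 1

def IG (k : ℤ) (W : Finset V) (c : Cfg V) (x : V) : Prop :=
  2 * k - 2 + nu k (c.ta {x} + 1) ≤ c.D W {x} - 1

theorem nu_pm {k : ℤ} (hk : 0 < k) (n e : ℤ) (h1 : e ≤ 1) (h2 : -1 ≤ e) :
    nu k (n + e) ≤ nu k n + 1 := by
  have h3 := nu_lip hk n (n + e)
  have h4 : |n + e - n| ≤ 1 := by rw [abs_le]; omega
  omega

/-- general transfer: a change which costs at most 2 on sets containing one of special vertices -/
theorem mem_cases {A : Finset V} {x : V} (hx : x ∈ A) : A = {x} ∨ 2 ≤ A.card := by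
  by_cases h : A.card = 1
  · obtain ⟨z, rfl⟩ := card_eq_one.mp h
    simp at hx; subst hx; exact Or.inl rfl
  · right
    have := card_pos.mpr ⟨x, hx⟩
    omega

theorem M_R {k : ℤ} (hk : 0 < k) {n : ℕ} (hM : ∀ n' < n, MainP V k n')
    {W : Finset V} {c : Cfg V} (hn : W.card = n) (h : MHyp k W c)
    (ih : ∀ c' : Cfg V, MHyp k W c' → Mt W c'.m < Mt W c.m → Sol k W c'.m c'.t)
    {x y : V} (hx : x ∈ W) (hy : y ∈ W) (hxy : x ≠ y) (hm : 1 ≤ c.m x y) (hO : OG k W c x)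
    (hs : SS k (∑ v ∈ W, c.a v + 1) (∑ v ∈ W, c.b v)) : Sol k W c.m c.t := by
  rcases M_gap hk hM hn h with hg | hg
  · exact hg
  have hb := h.base
  let a' : V → ℤ := fun u => c.a u + dl y u
  have hsa : ∀ A : Finset V, ∑ v ∈ A, a' v = ∑ v ∈ A, c.a v + (if y ∈ A then 1 else 0) := by
    intro A; simp only [a', sum_add_distrib, sum_dl]
  have hb' : Base k W (c.ori x y a' c.b) := by
    refine ori_base hb hx hy hxy hm (fun v => add_nonneg (hb.an v) (dl_nonneg _ _)) hb.bn ?_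
    rw [hsa]; simpa only [hy, if_true] using hs
  refine sol_orient hx hy (ih (c.ori x y a' c.b) ⟨hb', h.two, ?_⟩ ?_)
  · intro A hA h1 h2
    have h3 := h.ok A hA h1 h2
    have h4 := hg A hA
    unfold Ok at *
    rw [ori_D c hx hy, ori_ta, hsa]
    have e : ∑ v ∈ A, c.t v - (if x ∈ A then 1 else 0) + (if y ∈ A then 1 else 0) + ∑ v ∈ A, c.b v
        - (∑ v ∈ A, c.a v + (if y ∈ A then 1 else 0)) = c.ta A + (if x ∈ A then - 1 else 0) := by
      unfold Cfg.ta; split_ifs <;> ring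
    rw [e]
    by_cases hxA : x ∈ A
    · rcases mem_cases hxA with rfl | h5
      · unfold OG at hO
        unfold Cfg.D at hO
        have : ¬ (x ∈ ({x} : Finset V) ↔ y ∈ ({x} : Finset V)) := by simp [hxy.symm]
        rw [if_neg this]
        have : y ∉ ({x} : Finset V) := by simp [hxy.symm]
        simp only [mem_singleton_self, if_true, this, if_false]
        rw [← sub_eq_add_neg]
        omega
      · have h6 := h4 h5 h2
        have h7 := nu_pm hk (c.ta A) (-1) (by norm_num) le_rfl
        unfold Cfg.D at h6
        simp only [hxA, if_true]
        by_cases hyA : y ∈ A <;> simp only [hyA] <;> simp <;> omega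
    · simp only [hxA, if_false, add_zero]
      unfold Cfg.D at h3
      by_cases hyA : y ∈ A <;> simp only [hyA] <;> simp <;> omega
  · rw [ori_Mt c hx hy]; omega

theorem M_5 {k : ℤ} (hk : 0 < k)
    {W : Finset V} {c : Cfg V} (h : MHyp k W c)
    (hg : ∀ A ⊆ W, 2 ≤ A.card → A ≠ W → 2 * k + nu k (c.ta A) ≤ c.D W A)
    (ih : ∀ c' : Cfg V, MHyp k W c' → Mt W c'.m < Mt W c.m → Sol k W c'.m c'.t)
    {x y : V} (hx : x ∈ W) (hy : y ∈ W) (hxy : x ≠ y) (hm : 1 ≤ c.m x y) (hO : OG k W c x)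
    (hI : IG k W c y) : Sol k W c.m c.t := by
  have hb := h.base
  have hb' : Base k W (c.ori x y c.a c.b) := ori_base hb hx hy hxy hm hb.an hb.bn hb.ss
  refine sol_orient hx hy (ih (c.ori x y c.a c.b) ⟨hb', h.two, ?_⟩ ?_)
  · intro A hA h1 h2
    have h3 := h.ok A hA h1 h2
    have h4 := hg A hA
    unfold Ok at *
    rw [ori_D c hx hy, ori_ta]
    have e : ∑ v ∈ A, c.t v - (if x ∈ A then 1 else 0) + (if y ∈ A then 1 else 0) + ∑ v ∈ A, c.b v
        - ∑ v ∈ A, c.a v = c.ta A + (if x ∈ A then - 1 else 0) + (if y ∈ A then 1 else 0) := by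
      unfold Cfg.ta; split_ifs <;> ring
    rw [e]
    unfold OG at hO
    unfold IG at hI
    by_cases hxA : x ∈ A <;> by_cases hyA : y ∈ A
    · unfold Cfg.D at h3
      simp only [hxA, hyA]; simpa using h3
    · rcases mem_cases hxA with rfl | h5
      · unfold Cfg.D at hO
        have : ¬ (x ∈ ({x} : Finset V) ↔ y ∈ ({x} : Finset V)) := by simp [hxy.symm]
        rw [if_neg this]
        simp only [mem_singleton_self, if_true, hyA, if_false, add_zero]
        rw [← sub_eq_add_neg]
        omega
      · have h6 := h4 h5 h2
        have h7 := nu_pm hk (c.ta A) (-1) (by norm_num) le_rfl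
        unfold Cfg.D at h6
        simp only [hxA, hyA]; simp; omega
    · rcases mem_cases hyA with rfl | h5
      · unfold Cfg.D at hI
        have : ¬ (x ∈ ({y} : Finset V) ↔ y ∈ ({y} : Finset V)) := by simp [hxy]
        rw [if_neg this]
        simp only [mem_singleton_self, if_true, hxA, if_false, add_zero]
        omega
      · have h6 := h4 h5 h2
        have h7 := nu_pm hk (c.ta A) 1 (by norm_num) (by norm_num)
        unfold Cfg.D at h6
        simp only [hxA, hyA]; simp; omega
    · unfold Cfg.D at h3
      simp only [hxA, hyA]; simpa using h3
  · rw [ori_Mt c hx hy]; omega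

theorem M_conn {k : ℤ} (hk : 3 ≤ k) {W : Finset V} {c : Cfg V} (h : MHyp k W c)
    {A : Finset V} (hA : A ⊆ W) (h1 : A.Nonempty) (h2 : A ≠ W) :
    ∃ x ∈ A, ∃ y ∈ W \ A, 1 ≤ c.m x y := by
  have hb := h.base
  have h3 := h.ok A hA h1 h2
  have h4 := h.ok (W \ A) sdiff_subset (by
    rw [nonempty_iff_ne_empty]
    intro h5
    rw [sdiff_eq_empty_iff_subset] at h5
    exact h2 (Subset.antisymm hA h5)) (by
    intro h5
    obtain ⟨v, hv⟩ := h1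
    have := hA hv
    rw [← h5, mem_sdiff] at this
    exact this.2 hv)
  have h5 := nu_nonneg (show 0 < k by omega) (c.ta A)
  have h6 := nu_nonneg (show 0 < k by omega) (c.ta (W \ A))
  have h7 := hb.ss
  unfold Ok Cfg.D at h3 h4
  rw [dd_compl hb.sym hA] at h4
  rw [← sum_sdiff hA, ← sum_sdiff (f := c.b) hA] at h7
  have h8 : dd W A c.m ≠ 0 := by unfold SS at h7; omega
  by_contra hcon
  push Not at hcon
  apply h8
  refine sum_eq_zero fun x hx => sum_eq_zero fun y hy => ?_
  have := hcon x hx y hy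
  have := hb.nn x y
  omega

theorem M_edge {k : ℤ} (hk : 3 ≤ k) {W : Finset V} {c : Cfg V} (h : MHyp k W c)
    {x : V} (hx : x ∈ W) : ∃ y ∈ W, x ≠ y ∧ 1 ≤ c.m x y := by
  obtain ⟨x', hx', y, hy, hm⟩ := M_conn hk h (A := {x}) (singleton_subset_iff.mpr hx)
    (singleton_nonempty x) (by
      intro h1
      have := h.two
      rw [← h1, card_singleton] at this
      omega)
  rw [mem_singleton] at hx'
  subst hx'
  rw [mem_sdiff, mem_singleton] at hy
  exact ⟨y, hy.1, Ne.symm hy.2, hm⟩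

/-- change of certificate at one vertex -/
theorem M_cert {k : ℤ} (hk : 0 < k) {W : Finset V} {c : Cfg V} (h : MHyp k W c)
    (hg : ∀ A ⊆ W, 2 ≤ A.card → A ≠ W → 2 * k + nu k (c.ta A) ≤ c.D W A)
    {x : V} (hx : x ∈ W) (p q : ℤ) (hp : 0 ≤ c.a x + p) (hq : 0 ≤ c.b x + q)
    (hpq : |q - p| ≤ p + q + 2)
    (hs : SS k (∑ v ∈ W, c.a v + p) (∑ v ∈ W, c.b v + q))
    (hxo : 2 * k - 2 + nu k (c.ta {x} + (q - p)) ≤ c.D W {x} + (p + q)) :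
    MHyp k W ⟨c.m, c.t, fun v => c.a v + p * dl x v, fun v => c.b v + q * dl x v⟩ := by
  have hb := h.base
  have hsa : ∀ A : Finset V, ∑ v ∈ A, (c.a v + p * dl x v)
      = ∑ v ∈ A, c.a v + p * (if x ∈ A then 1 else 0) := by
    intro A; simp only [sum_add_distrib, ← mul_sum, sum_dl]
  have hsb : ∀ A : Finset V, ∑ v ∈ A, (c.b v + q * dl x v)
      = ∑ v ∈ A, c.b v + q * (if x ∈ A then 1 else 0) := by
    intro A; simp only [sum_add_distrib, ← mul_sum, sum_dl]
  refine ⟨⟨hb.sym, hb.nn, ?_, ?_, hb.tot, hb.par, ?_⟩, h.two, ?_⟩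
  · intro v
    have := hb.an v
    by_cases hv : v = x
    · subst hv; simpa [dl] using hp
    · simpa [dl, hv] using this
  · intro v
    have := hb.bn v
    by_cases hv : v = x
    · subst hv; simpa [dl] using hq
    · simpa [dl, hv] using this
  · simp only [hsa, hsb, hx, if_true, mul_one]; exact hs
  · intro A hA h1 h2
    have h3 := h.ok A hA h1 h2
    unfold Ok Cfg.D Cfg.ta at *
    simp only [hsa, hsb]
    by_cases hxA : x ∈ A
    · simp only [hxA, if_true, mul_one]
      rw [show ∑ v ∈ A, c.t v + (∑ v ∈ A, c.b v + q) - (∑ v ∈ A, c.a v + p)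
        = ∑ v ∈ A, c.t v + ∑ v ∈ A, c.b v - ∑ v ∈ A, c.a v + (q - p) by ring]
      rcases mem_cases hxA with rfl | h5
      · omega
      · have h6 := hg A hA h5 h2
        have h7 := nu_lip hk (∑ v ∈ A, c.t v + ∑ v ∈ A, c.b v - ∑ v ∈ A, c.a v)
          (∑ v ∈ A, c.t v + ∑ v ∈ A, c.b v - ∑ v ∈ A, c.a v + (q - p))
        rw [add_sub_cancel_left] at h7
        omega
    · simpa only [hxA, if_false, mul_zero, add_zero] using h3

theorem M_allOG {k : ℤ} (hk : 3 ≤ k) {n : ℕ} (hM : ∀ n' < n, MainP V k n')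
    {W : Finset V} {c : Cfg V} (hn : W.card = n) (h : MHyp k W c)
    (hg : ∀ A ⊆ W, 2 ≤ A.card → A ≠ W → 2 * k + nu k (c.ta A) ≤ c.D W A)
    (ih : ∀ c' : Cfg V, MHyp k W c' → Mt W c'.m < Mt W c.m → Sol k W c'.m c'.t)
    (ih2 : ∀ c' : Cfg V, MHyp k W c' → c'.m = c.m →
      ∑ v ∈ W, c'.a v + ∑ v ∈ W, c'.b v < ∑ v ∈ W, c.a v + ∑ v ∈ W, c.b v → Sol k W c'.m c'.t)
    (hO : ∀ x ∈ W, OG k W c x) : Sol k W c.m c.t := by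
  have hk0 : 0 < k := by omega
  have hb := h.base
  have htwo := h.two
  have hsum : ∀ (f : V → ℤ) (r : ℤ) (x : V), x ∈ W →
      ∑ v ∈ W, (f v + r * dl x v) = ∑ v ∈ W, f v + r := by
    intro f r x hx
    simp only [sum_add_distrib, ← mul_sum, sum_dl, hx, if_true, mul_one]
  have hss := hb.ss
  have hsbn : 0 ≤ ∑ v ∈ W, c.b v := sum_nonneg fun v _ => hb.bn v
  by_cases hS : SS k (∑ v ∈ W, c.a v + 1) (∑ v ∈ W, c.b v)
  · obtain ⟨x, hx⟩ : W.Nonempty := card_pos.mp (by omega)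
    obtain ⟨y, hy, hxy, hm⟩ := M_edge hk h hx
    exact M_R hk0 hM hn h ih hx hy hxy hm (hO x hx) hS
  by_cases hB : ∃ x ∈ W, 1 ≤ c.b x
  · obtain ⟨x, hx, hbx⟩ := hB
    have hOx := hO x hx
    unfold OG at hOx
    have := M_cert hk0 h hg hx 0 (-1) (by simpa using hb.an x) (by omega) (by norm_num)
      (by unfold SS at *; omega) (by
        rw [show c.ta {x} + (-1 - 0) = c.ta {x} - 1 by ring]; omega)
    have key := ih2 _ this rfl (by simp only [hsum _ _ x hx]; omega)
    exact key
  have hb0 : ∑ v ∈ W, c.b v = 0 := by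
    refine sum_eq_zero fun v hv => ?_
    have := hb.bn v
    by_contra hne
    exact hB ⟨v, hv, by omega⟩
  have ha0 : ∑ v ∈ W, c.a v = 2 * k - 1 := by unfold SS at *; omega
  obtain ⟨x, hx, hax⟩ : ∃ x ∈ W, 1 ≤ c.a x := by
    by_contra hcon
    push Not at hcon
    have : ∑ v ∈ W, c.a v ≤ 0 := sum_nonpos fun v hv => by have := hcon v hv; omega
    omega
  by_cases hI : IG k W c x
  · unfold IG at hI
    have := M_cert hk0 h hg hx (-1) 0 (by omega) (by simpa using hb.bn x) (by norm_num)
      (by unfold SS at *; omega) (by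
        rw [show c.ta {x} + (0 - -1) = c.ta {x} + 1 by ring]; omega)
    have key := ih2 _ this rfl (by simp only [hsum _ _ x hx]; omega)
    exact key
  have hOx := hO x hx
  unfold OG at hOx
  unfold IG at hI
  have hok : Ok k W c {x} := h.ok {x} (singleton_subset_iff.mpr hx) (singleton_nonempty x) (by
      intro h1
      rw [← h1, card_singleton] at htwo
      omega)
  have hev := gap_even hk0 hb (singleton_subset_iff.mpr hx)
  unfold Ok at hok
  obtain ⟨hs0, hs1, q, hq⟩ := nu_spec hk0 (c.ta {x})
  have hp1 := nu_pm hk0 (c.ta {x}) 1 (by norm_num) (by norm_num)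
  have hk1 := nu_le_k hk0 (c.ta {x} + 1)
  have hn1 := nu_nonneg hk0 (c.ta {x} - 1)
  have hD : c.D W {x} = 2 * k - 2 + nu k (c.ta {x}) := by omega
  set s := nu k (c.ta {x}) with hs
  have hs1' : 1 ≤ s := by omega
  have hqq : c.ta {x} = 2 * k * q + s := by
    rcases hq with hq | hq
    · exact hq
    · exfalso
      have h1 := nu_le hk0 (c.ta {x} + 1) q
      have h2 : |c.ta {x} + 1 - 2 * k * q| ≤ s - 1 := by rw [abs_le]; omega
      omega
  have hsk : s ≤ k - 1 := by
    have h1 := nu_even hk0 (c.ta {x} + 1)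
    have h2 := nu_even hk0 (c.ta {x})
    omega
  have hc2 := M_cert hk0 h hg hx (-1) (k - s) (by omega)
    (by have := hb.bn x; omega) (by rw [abs_le]; omega)
    (by unfold SS; omega) (by
      have h1 := nu_le hk0 (c.ta {x} + (k - s - -1)) (q + 1)
      have h2 : |c.ta {x} + (k - s - -1) - 2 * k * (q + 1)| ≤ k - 1 := by
        rw [mul_add, abs_le]; omega
      omega)
  obtain ⟨y, hyW, hyx⟩ := exists_ne_of_two_le htwo x
  obtain ⟨w, hw, hyw, hm⟩ := M_edge hk h hyW
  have hOy := hO y hyW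
  have key := M_R hk0 hM hn hc2 (fun c' h1 h2 => ih c' h1 h2) hyW hw hyw hm
    (by
      unfold OG Cfg.ta Cfg.D at hOy ⊢
      simpa [dl, hyx] using hOy)
    (by
      simp only [hsum _ _ x hx]
      unfold SS; omega)
  exact key

theorem sol_rev {k : ℤ} {W : Finset V} {m : V → V → ℤ} {t : V → ℤ}
    (h : Sol k W m (fun u => - t u)) : Sol k W m t := by
  obtain ⟨o, h0, h1, h2⟩ := h
  refine ⟨fun u v => o v u, fun u hu v hv => h0 v hv u hu, ?_, ?_⟩
  · intro u hu v hv huv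
    rw [← h1 u hu v hv huv]; ring
  · intro u hu
    have := h2 u hu
    rw [← dvd_neg] at this
    have e : ∑ v ∈ W, (o v u - o u v) - t u = -(∑ v ∈ W, (o u v - o v u) - - t u) := by
      simp only [sum_sub_distrib]; ring
    rw [e]; exact this

def Cfg.rev (c : Cfg V) : Cfg V := ⟨c.m, fun u => - c.t u, c.b, c.a⟩

theorem rev_D (c : Cfg V) (W A : Finset V) : c.rev.D W A = c.D W A := by
  unfold Cfg.D Cfg.rev; ring

theorem rev_ta (c : Cfg V) (A : Finset V) : c.rev.ta A = - c.ta A := by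
  unfold Cfg.ta Cfg.rev; simp only [sum_neg_distrib]; ring

theorem rev_MHyp {k : ℤ} (hk : 0 < k) {W : Finset V} {c : Cfg V} (h : MHyp k W c) :
    MHyp k W c.rev := by
  have hb := h.base
  refine ⟨⟨hb.sym, hb.nn, hb.bn, hb.an, ?_, ?_, ?_⟩, h.two, ?_⟩
  · simp only [Cfg.rev, sum_neg_distrib, dvd_neg]; exact hb.tot
  · intro A hA
    have := hb.par A hA
    simp only [Cfg.rev, sum_neg_distrib]
    omega
  · have := hb.ss
    unfold SS at *
    simp only [Cfg.rev]
    omega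
  · intro A hA h1 h2
    have := h.ok A hA h1 h2
    unfold Ok at *
    rwa [rev_D, rev_ta, nu_neg hk]

theorem M_exc {k : ℤ} (hk : 3 ≤ k) {n : ℕ} (hE : EP V k n)
    {W : Finset V} {c : Cfg V} (hn : W.card = n) (h : MHyp k W c) {x : V} (hx : x ∈ W)
    (hO : ¬ OG k W c x) (hI : ¬ IG k W c x) : Sol k W c.m c.t := by
  have hk0 : 0 < k := by omega
  have hb := h.base
  have htwo := h.two
  unfold OG at hO
  unfold IG at hI
  have hxW : {x} ≠ W := by
    intro h1
    rw [← h1, card_singleton] at htwo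
    omega
  have hok := h.ok {x} (singleton_subset_iff.mpr hx) (singleton_nonempty x) hxW
  have hev := gap_even hk0 hb (singleton_subset_iff.mpr hx)
  unfold Ok at hok
  have hp1 := nu_pm hk0 (c.ta {x}) 1 (by norm_num) (by norm_num)
  have hp2 := nu_pm hk0 (c.ta {x}) (-1) (by norm_num) (by norm_num)
  have hn0 : nu k (c.ta {x}) = 0 := by
    by_contra hne
    rcases nu_step hk0 _ hne with h1 | h1 <;> omega
  have hbal := nu_eq_zero hk0 hn0
  have hta : c.ta {x} = c.t x + c.b x - c.a x := by simp [Cfg.ta]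
  refine hE W c x hn ⟨hb, hx, htwo, by rwa [← hta], ?_, ?_⟩
  · have h1 := h.ok (W \ {x}) sdiff_subset (by
      obtain ⟨y, hy, hyx⟩ := exists_ne_of_two_le htwo x
      exact ⟨y, by simp [hy, hyx]⟩) (by
      intro h5
      have := hx
      rw [← h5] at this
      simp at this)
    unfold Ok Cfg.D at h1
    rw [dd_compl hb.sym (singleton_subset_iff.mpr hx), sdiff_singleton_eq_erase] at h1
    have h2 : nu k (c.ta (W.erase x)) = nu k (∑ v ∈ W, c.b v - ∑ v ∈ W, c.a v) := by
      apply nu_congr hk0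
      have h3 := ta_split (c := c) hx
      rw [← hta] at h3
      have h4 : c.ta (W.erase x) - (∑ v ∈ W, c.b v - ∑ v ∈ W, c.a v)
          = ∑ v ∈ W, c.t v - c.ta {x} := by
        unfold Cfg.ta at *; omega
      rw [h4]
      exact dvd_sub hb.tot hbal
    have h3 := SS_lemma hk0 (sum_nonneg fun v _ => hb.an v) (sum_nonneg fun v _ => hb.bn v) hb.ss
    rw [h2] at h1
    rw [← add_sum_erase _ c.a hx, ← add_sum_erase _ c.b hx] at h1 h3
    omega
  · intro A hA h1 h2
    refine h.ok A hA ?_ ?_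
    · obtain ⟨v, hv⟩ := h1
      exact ⟨v, (mem_erase.mp hv).2⟩
    · rintro rfl
      exact h2 (insert_eq_of_mem hx)

theorem M_core {k : ℤ} (hk : 3 ≤ k) {n : ℕ} (hM : ∀ n' < n, MainP V k n') (hE : EP V k n)
    {W : Finset V} {c : Cfg V} (hn : W.card = n) (h : MHyp k W c)
    (ih : ∀ c' : Cfg V, MHyp k W c' → Mt W c'.m < Mt W c.m → Sol k W c'.m c'.t)
    (ih2 : ∀ c' : Cfg V, MHyp k W c' → c'.m = c.m →
      ∑ v ∈ W, c'.a v + ∑ v ∈ W, c'.b v < ∑ v ∈ W, c.a v + ∑ v ∈ W, c.b v → Sol k W c'.m c'.t) :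
    Sol k W c.m c.t := by
  classical
  have hk0 : 0 < k := by omega
  rcases M_gap hk0 hM hn h with hg | hg
  · exact hg
  by_cases hX : ∃ x ∈ W, ¬ OG k W c x ∧ ¬ IG k W c x
  · obtain ⟨x, hx, h1, h2⟩ := hX
    exact M_exc hk hE hn h hx h1 h2
  push Not at hX
  by_cases hO : ∀ x ∈ W, OG k W c x
  · exact M_allOG hk hM hn h hg ih ih2 hO
  by_cases hI : ∀ x ∈ W, IG k W c x
  · apply sol_rev
    refine M_allOG hk hM hn (rev_MHyp hk0 h) ?_ ih ?_ ?_
    · intro A h1 h2 h3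
      rw [rev_D, rev_ta, nu_neg hk0]
      exact hg A h1 h2 h3
    · intro c' h1 h2 h3
      refine ih2 c' h1 h2 ?_
      simp only [Cfg.rev] at h3
      omega
    · intro x hx
      have := hI x hx
      unfold OG; unfold IG at this
      rw [rev_D, rev_ta, ← nu_neg hk0]
      convert this using 3
      ring
  push Not at hO hI
  obtain ⟨y0, hy0, hy0'⟩ := hO
  obtain ⟨x0, hx0, hx0'⟩ := hI
  obtain ⟨x, hx, y, hy, hm⟩ := M_conn hk h (A := W.filter (fun v => OG k W c v))
    (filter_subset _ _) ⟨x0, by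
      rw [mem_filter]
      refine ⟨hx0, ?_⟩
      by_contra h1
      exact hx0' (hX x0 hx0 h1)⟩ (by
      intro h1
      rw [← h1, mem_filter] at hy0
      exact hy0' hy0.2)
  rw [mem_filter] at hx
  rw [mem_sdiff, mem_filter] at hy
  have hyO : ¬ OG k W c y := fun h1 => hy.2 ⟨hy.1, h1⟩
  exact M_5 hk0 h hg ih hx.1 hy.1 (by rintro rfl; exact hyO hx.2) hm hx.2 (hX y hy.1 hyO)

theorem M_step {k : ℤ} (hk : 3 ≤ k) {n : ℕ} (hM : ∀ n' < n, MainP V k n') (hE : EP V k n) :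
    MainP V k n := by
  intro W c hn hb hne hok
  by_cases h2 : 2 ≤ W.card
  · have h : MHyp k W c := ⟨hb, h2, hok⟩
    clear hok hb
    induction hN : (Mt W c.m).toNat using Nat.strong_induction_on generalizing c with
    | _ N ih =>
    subst hN
    induction hN' : (∑ v ∈ W, c.a v + ∑ v ∈ W, c.b v).toNat using Nat.strong_induction_on
      generalizing c with
    | _ N' ih' =>
    subst hN'
    refine M_core hk hM hE hn h ?_ ?_
    · intro c' h1 h3
      have := Mt_nonneg (W := W) h1.base.nn
      exact ih _ (by omega) c' h1 rfl
    · intro c' h1 h3 h4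
      have h5 : 0 ≤ ∑ v ∈ W, c'.a v := sum_nonneg fun v _ => h1.base.an v
      have h6 : 0 ≤ ∑ v ∈ W, c'.b v := sum_nonneg fun v _ => h1.base.bn v
      refine ih' _ (by omega) c' h1 ?_ rfl
      rw [h3]; exact ih
  · have h1 : W.card = 1 := by have := card_pos.mpr hne; omega
    obtain ⟨x, rfl⟩ := card_eq_one.mp h1
    refine ⟨fun _ _ => 0, by simp, ?_, ?_⟩
    · intro u hu v hv huv
      simp at hu hv; subst hu; subst hv; exact absurd rfl huv
    · intro u hu
      simp at hu; subst hu
      simpa using hb.tot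

theorem main_all {k : ℤ} (hk : 3 ≤ k) (n : ℕ) : MainP V k n ∧ EP V k n := by
  induction n using Nat.strong_induction_on with
  | _ n ih =>
  have hE : EP V k n := E_step (by omega) (fun n' h => (ih n' h).1) (fun n' h => (ih n' h).2)
  exact ⟨M_step hk (fun n' h => (ih n' h).1) hE, hE⟩

end PartA4

section PartB
open Finset
set_option linter.unusedSectionVars false
variable {V : Type} [DecidableEq V] [Fintype V]

def vec (e : V × V) : V → ℚ := Pi.single e.1 1 - Pi.single e.2 1

/-- span of the vectors of an edge set -/
def spn (S : Finset (V × V)) : Submodule ℚ (V → ℚ) := Submodule.span ℚ (vec '' (S : Set (V × V)))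

theorem spn_mono {S T : Finset (V × V)} (h : S ⊆ T) : spn S ≤ spn T :=
  Submodule.span_mono (Set.image_mono (by exact_mod_cast h))

theorem mem_spn {S : Finset (V × V)} {e : V × V} (h : e ∈ S) : vec e ∈ spn S :=
  Submodule.subset_span ⟨e, by exact_mod_cast h, rfl⟩

theorem spn_le {S : Finset (V × V)} {p : Submodule ℚ (V → ℚ)} (h : ∀ e ∈ S, vec e ∈ p) :
    spn S ≤ p := by
  refine Submodule.span_le.mpr ?_
  rintro _ ⟨e, he, rfl⟩
  exact h e (by exact_mod_cast he)

def Ind (S : Finset (V × V)) : Prop := LinearIndepOn ℚ vec (S : Set (V × V))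

theorem ind_insert {S : Finset (V × V)} {e : V × V} (h : Ind S) (he : vec e ∉ spn S) :
    Ind (insert e S) := by
  unfold Ind at *
  rw [coe_insert]
  exact LinearIndepOn.insert h he

theorem ind_notMem {S : Finset (V × V)} {g : V × V} (h : Ind S) (hg : g ∈ S) :
    vec g ∉ spn (S.erase g) := by
  have h1 : Ind (insert g (S.erase g)) := by rwa [insert_erase hg]
  unfold Ind at h1
  rw [coe_insert, linearIndepOn_insert (by simp)] at h1
  exact h1.2

structure Pk (E : Finset (V × V)) {m : ℕ} (F : Fin m → Finset (V × V)) : Prop where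
  sub : ∀ i, F i ⊆ E
  disj : ∀ i j, i ≠ j → Disjoint (F i) (F j)
  ind : ∀ i, Ind (F i)

def tot {m : ℕ} (F : Fin m → Finset (V × V)) : ℕ := ∑ i, (F i).card

def MaxPk (E : Finset (V × V)) {m : ℕ} (F : Fin m → Finset (V × V)) : Prop :=
  Pk E F ∧ ∀ F' : Fin m → Finset (V × V), Pk E F' → tot F' ≤ tot F

def Unc {m : ℕ} (F : Fin m → Finset (V × V)) (e : V × V) : Prop := ∀ i, e ∉ F i

theorem pk_update {E : Finset (V × V)} {m : ℕ} {F : Fin m → Finset (V × V)} (h : Pk E F)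
    (i : Fin m) (S : Finset (V × V)) (hS : S ⊆ E) (hI : Ind S)
    (hd : ∀ j, j ≠ i → Disjoint S (F j)) : Pk E (Function.update F i S) := by
  refine ⟨?_, ?_, ?_⟩
  · intro j
    by_cases hj : j = i
    · subst hj; simpa using hS
    · simpa [hj] using h.sub j
  · intro j l hjl
    by_cases hj : j = i
    · subst hj
      simpa [hjl.symm] using hd l hjl.symm
    · by_cases hl : l = i
      · subst hl
        simpa [hj] using (hd j hj).symm
      · simpa [hj, hl] using h.disj j l hjl
  · intro j
    by_cases hj : j = i
    · subst hj; simpa using hI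
    · simpa [hj] using h.ind j

theorem tot_update {m : ℕ} (F : Fin m → Finset (V × V)) (i : Fin m) (S : Finset (V × V)) :
    tot (Function.update F i S) + (F i).card = tot F + S.card := by
  unfold tot
  rw [← add_sum_erase univ _ (mem_univ i), ← add_sum_erase univ (fun j => (F j).card) (mem_univ i)]
  rw [sum_congr (s₁ := univ.erase i) rfl (g := fun j => (F j).card)]
  · simp only [Function.update_self]; omega
  · intro j hj
    rw [Function.update_of_ne (mem_erase.mp hj).1]

theorem max_span {E : Finset (V × V)} {m : ℕ} {F : Fin m → Finset (V × V)} (h : MaxPk E F)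
    {e : V × V} (he : e ∈ E) (hu : Unc F e) (i : Fin m) : vec e ∈ spn (F i) := by
  by_contra hcon
  have h1 := h.2 _ (pk_update h.1 i (insert e (F i)) (insert_subset he (h.1.sub i))
    (ind_insert (h.1.ind i) hcon) (by
      intro j hj
      rw [disjoint_insert_left]
      exact ⟨hu j, h.1.disj i j hj.symm⟩))
  have h2 := tot_update F i (insert e (F i))
  rw [card_insert_of_notMem (hu i)] at h2
  omega

def ex {m : ℕ} (F : Fin m → Finset (V × V)) (i : Fin m) (e g : V × V) : Fin m → Finset (V × V) :=
  Function.update F i (insert e ((F i).erase g))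

/-- a legal exchange -/
structure Legal (E : Finset (V × V)) {m : ℕ} (F : Fin m → Finset (V × V)) (i : Fin m)
    (e g : V × V) : Prop where
  eE : e ∈ E
  unc : Unc F e
  gF : g ∈ F i
  sp : vec e ∉ spn ((F i).erase g)

theorem ex_max {E : Finset (V × V)} {m : ℕ} {F : Fin m → Finset (V × V)} (h : MaxPk E F)
    {i : Fin m} {e g : V × V} (hl : Legal E F i e g) : MaxPk E (ex F i e g) := by
  have hp : Pk E (ex F i e g) := by
    refine pk_update h.1 i _ (insert_subset hl.eE ((erase_subset _ _).trans (h.1.sub i)))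
      (ind_insert ?_ hl.sp) ?_
    · exact LinearIndepOn.mono (h.1.ind i) (by exact_mod_cast erase_subset g (F i))
    · intro j hj
      rw [disjoint_insert_left]
      exact ⟨hl.unc j, (h.1.disj i j hj.symm).mono_left (erase_subset _ _)⟩
  refine ⟨hp, ?_⟩
  have h2 := tot_update F i (insert e ((F i).erase g))
  rw [card_insert_of_notMem (fun h => hl.unc i (mem_of_mem_erase h)),
    card_erase_of_mem hl.gF] at h2
  have h3 := card_pos.mpr ⟨g, hl.gF⟩
  intro F' hF'
  have := h.2 F' hF'
  unfold ex
  omega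

theorem ex_legal {E : Finset (V × V)} {m : ℕ} {F : Fin m → Finset (V × V)} (h : MaxPk E F)
    {i : Fin m} {e g : V × V} (hl : Legal E F i e g) :
    Legal E (ex F i e g) i g e ∧ Unc (ex F i e g) g := by
  have hge : g ≠ e := by rintro rfl; exact hl.unc i hl.gF
  have hu : Unc (ex F i e g) g := by
    intro j
    unfold ex
    by_cases hj : j = i
    · subst hj; simp [hge]
    · rw [Function.update_of_ne hj]
      exact fun h' => Finset.disjoint_left.mp (h.1.disj i j (Ne.symm hj)) hl.gF h'
  refine ⟨⟨h.1.sub i hl.gF, hu, by simp [ex], ?_⟩, hu⟩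
  have : (ex F i e g i).erase e = (F i).erase g := by
    unfold ex
    rw [Function.update_self, erase_insert (fun h => hl.unc i (mem_of_mem_erase h))]
  rw [this]
  exact ind_notMem (h.1.ind i) hl.gF

def Stp (E : Finset (V × V)) {m : ℕ} (F F' : Fin m → Finset (V × V)) : Prop :=
  ∃ i e g, Legal E F i e g ∧ F' = ex F i e g

theorem exists_support {S : Finset (V × V)} (hS : Ind S) {e : V × V} (he : vec e ∈ spn S)
    (R : Finset (V × V)) (hR : ∀ g ∈ S, vec e ∉ spn (S.erase g) → g ∈ R) : vec e ∈ spn (S ∩ R) := by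
  unfold spn at he
  rw [Submodule.mem_span_image_finset_iff_exists_fun ℚ] at he
  obtain ⟨c0, hc0⟩ := he
  obtain ⟨c, hc⟩ : ∃ c : V × V → ℚ, ∑ g ∈ S, c g • vec g = vec e := by
    refine ⟨fun g => if h : g ∈ S then c0 ⟨g, h⟩ else 0, ?_⟩
    rw [← hc0, ← Finset.sum_coe_sort]
    refine Finset.sum_congr rfl fun x _ => ?_
    simp
  rw [← hc]
  refine Submodule.sum_mem _ fun g hg => ?_
  by_cases h0 : c g = 0
  · rw [h0, zero_smul]; exact Submodule.zero_mem _
  refine Submodule.smul_mem _ _ (mem_spn (mem_inter.mpr ⟨hg, hR g hg ?_⟩))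
  intro hcon
  apply ind_notMem hS hg
  rw [← hc, ← add_sum_erase _ _ hg] at hcon
  have h1 : ∑ x ∈ S.erase g, c x • vec x ∈ spn (S.erase g) :=
    Submodule.sum_mem _ fun x hx => Submodule.smul_mem _ _ (mem_spn hx)
  have h2 : c g • vec g ∈ spn (S.erase g) := by
    have := Submodule.sub_mem _ hcon h1
    simpa using this
  exact (Submodule.smul_mem_iff _ h0).mp h2

theorem reach_span {E : Finset (V × V)} {m : ℕ} {F0 : Fin m → Finset (V × V)} (h0 : MaxPk E F0) :
    ∃ R : Finset (V × V), R ⊆ E ∧ (∀ e ∈ E, Unc F0 e → e ∈ R) ∧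
      ∀ i, ∀ e ∈ R, vec e ∈ spn (F0 i ∩ R) := by
  classical
  let Rc : (Fin m → Finset (V × V)) → Prop := Relation.ReflTransGen (Stp E) F0
  have hmax : ∀ F, Rc F → MaxPk E F := by
    intro F hF
    induction hF with
    | refl => exact h0
    | tail _ hs ih =>
      obtain ⟨i, e, g, hl, rfl⟩ := hs
      exact ex_max ih hl
  let R : Finset (V × V) := E.filter (fun e => ∃ F, Rc F ∧ Unc F e)
  have claim1 : ∀ F, Rc F → ∀ e ∈ E, Unc F e → ∀ i, vec e ∈ spn (F i ∩ R) := by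
    intro F hF e he hu i
    have hm := hmax F hF
    refine exists_support (hm.1.ind i) (max_span hm he hu i) R ?_
    intro g hg hsp
    have hl : Legal E F i e g := ⟨he, hu, hg, hsp⟩
    refine mem_filter.mpr ⟨hm.1.sub i hg, ex F i e g, ?_, (ex_legal hm hl).2⟩
    exact Relation.ReflTransGen.tail hF ⟨i, e, g, hl, rfl⟩
  have claim2 : ∀ F, Rc F → ∀ i, spn (F i ∩ R) = spn (F0 i ∩ R) := by
    intro F hF
    induction hF with
    | refl => intro i; rfl
    | @tail F F' hF hs ih =>
      intro j
      rw [← ih j]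
      have hF' : Rc F' := Relation.ReflTransGen.tail hF hs
      obtain ⟨i, e, g, hl, rfl⟩ := hs
      have hm := hmax F hF
      by_cases hj : j = i
      · subst hj
        have h1 := claim1 F hF e hl.eE hl.unc j
        have hl' := (ex_legal hm hl).1
        have h2 := claim1 _ hF' g hl'.eE hl'.unc j
        apply le_antisymm
        · apply spn_le
          intro f hf
          rw [mem_inter] at hf
          obtain ⟨hf1, hf2⟩ := hf
          simp only [ex, Function.update_self, mem_insert, mem_erase] at hf1
          rcases hf1 with rfl | hf1
          · exact h1
          · exact mem_spn (mem_inter.mpr ⟨hf1.2, hf2⟩)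
        · apply spn_le
          intro f hf
          rw [mem_inter] at hf
          by_cases hfg : f = g
          · subst hfg; exact h2
          · refine mem_spn (mem_inter.mpr ⟨?_, hf.2⟩)
            simp [ex, hfg, hf.1]
      · simp [ex, hj]
  refine ⟨R, filter_subset _ _, ?_, ?_⟩
  · intro e he hu
    exact mem_filter.mpr ⟨he, F0, Relation.ReflTransGen.refl, hu⟩
  · intro i e he
    obtain ⟨he, F, hF, hu⟩ := mem_filter.mp he
    rw [← claim2 F hF i]
    exact claim1 F hF e he hu i

/-- edge `e` crosses `A` -/
def Cr (A : Finset V) (e : V × V) : Prop := ¬ (e.1 ∈ A ↔ e.2 ∈ A)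

instance (A : Finset V) : DecidablePred (Cr A) := fun e => by unfold Cr; infer_instance

/-- the functional given by `f` -/
def fnl (f : V → ℚ) : (V → ℚ) →ₗ[ℚ] ℚ where
  toFun x := ∑ v, f v * x v
  map_add' x y := by simp only [Pi.add_apply, mul_add, sum_add_distrib]
  map_smul' c x := by
    simp only [Pi.smul_apply, smul_eq_mul, RingHom.id_apply, mul_sum]
    exact sum_congr rfl fun v _ => by ring

theorem fnl_vec (f : V → ℚ) (e : V × V) : fnl f (vec e) = f e.1 - f e.2 := by
  simp [fnl, vec, mul_sub, sum_sub_distrib, Pi.single_apply]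

theorem fnl_spn {f : V → ℚ} {S : Finset (V × V)} (h : ∀ e ∈ S, f e.1 = f e.2) {e : V × V}
    (he : vec e ∈ spn S) : f e.1 = f e.2 := by
  have h1 : spn S ≤ LinearMap.ker (fnl f) := by
    apply spn_le
    intro g hg
    rw [LinearMap.mem_ker, fnl_vec, h g hg, sub_self]
  have h2 := h1 he
  rw [LinearMap.mem_ker, fnl_vec] at h2
  linarith

theorem ind_card [Nonempty V] {S : Finset (V × V)} (h : Ind S) : S.card + 1 ≤ Fintype.card V := by
  have h1 : Module.finrank ℚ (spn S) = S.card := by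
    unfold spn
    have := finrank_span_eq_card (R := ℚ) (b := fun e : (S : Set (V × V)) => vec (e : V × V)) h
    rw [Set.image_eq_range]
    rw [this]; simp
  have h2 : spn S < ⊤ := by
    rw [lt_top_iff_ne_top]
    intro h3
    obtain ⟨v⟩ := ‹Nonempty V›
    have h4 : spn S ≤ LinearMap.ker (fnl (fun _ => 1)) := by
      apply spn_le
      intro g hg
      rw [LinearMap.mem_ker, fnl_vec, sub_self]
    rw [h3] at h4
    have h5 : (Pi.single v 1 : V → ℚ) ∈ LinearMap.ker (fnl (fun _ : V => (1 : ℚ))) := h4 trivial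
    rw [LinearMap.mem_ker] at h5
    simp [fnl] at h5
  have h3 := Submodule.finrank_lt h2.ne
  rw [h1, Module.finrank_pi] at h3
  omega

theorem tree_packing [Nonempty V] (E : Finset (V × V)) (m : ℕ)
    (hcut : ∀ A : Finset V, A.Nonempty → A ≠ univ → 2 * m ≤ (E.filter (Cr A)).card) :
    ∃ F : Fin m → Finset (V × V), (∀ i, F i ⊆ E) ∧ (∀ i j, i ≠ j → Disjoint (F i) (F j)) ∧
      ∀ i, ∀ A : Finset V, A.Nonempty → A ≠ univ → ∃ e ∈ F i, Cr A e := by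
  classical
  rcases Nat.eq_zero_or_pos m with rfl | hm0
  · exact ⟨fun _ => ∅, fun i => i.elim0, fun i => i.elim0, fun i => i.elim0⟩
  obtain ⟨F, hF, hFmax⟩ : ∃ F : Fin m → Finset (V × V), Pk E F ∧
      ∀ F' : Fin m → Finset (V × V), Pk E F' → tot F' ≤ tot F := by
    obtain ⟨F, hF, hF'⟩ := Finset.exists_max_image
      (univ.filter (fun F : Fin m → Finset (V × V) => Pk E F)) tot
      ⟨fun _ => ∅, by
        rw [mem_filter]
        refine ⟨mem_univ _, fun _ => empty_subset _, fun _ _ _ => disjoint_empty_left _, fun _ => ?_⟩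
        unfold Ind; simp⟩
    exact ⟨F, (mem_filter.mp hF).2, fun F' h => hF' F' (mem_filter.mpr ⟨mem_univ _, h⟩)⟩
  obtain ⟨R, hRE, hRu, hRs⟩ := reach_span ⟨hF, hFmax⟩
  let st : Setoid V :=
    { r := fun u v => ∀ f : V → ℚ, (∀ e ∈ R, f e.1 = f e.2) → f u = f v
      iseqv := ⟨fun _ _ _ => rfl, fun h f hf => (h f hf).symm,
        fun h h' f hf => (h f hf).trans (h' f hf)⟩ }
  let π : V → Quotient st := fun v => Quotient.mk st v
  have hπ : ∀ u v, π u = π v ↔ ∀ f : V → ℚ, (∀ e ∈ R, f e.1 = f e.2) → f u = f v :=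
    fun u v => Quotient.eq (r := st)
  have hπR : ∀ e ∈ R, π e.1 = π e.2 := fun e he => (hπ _ _).mpr fun f hf => hf e he
  have : Fintype (Quotient st) := Fintype.ofFinite _
  by_cases hq : ∀ u v, π u = π v
  · refine ⟨F, hF.sub, hF.disj, ?_⟩
    intro i A hA hA'
    by_contra hcon
    push Not at hcon
    obtain ⟨u, hu⟩ := hA
    obtain ⟨v, hv⟩ : ∃ v, v ∉ A := by
      by_contra h1
      push Not at h1
      exact hA' (eq_univ_iff_forall.mpr h1)
    let f : V → ℚ := fun w => if w ∈ A then 1 else 0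
    have h1 : ∀ e ∈ F i, f e.1 = f e.2 := by
      intro e he
      have := hcon e he
      unfold Cr at this
      push Not at this
      simp only [f, this]
    have h2 := (hπ u v).mp (hq u v) f (fun e he =>
      fnl_spn (fun g hg => h1 g (mem_inter.mp hg).1) (hRs i e he))
    simp [f, hu, hv] at h2
  exfalso
  push Not at hq
  obtain ⟨u0, v0, huv⟩ := hq
  -- number of edges outside `R`
  set Q := Fintype.card (Quotient st) with hQ
  have hER : m * Q ≤ (E \ R).card := by
    have h1 : ∀ q : Quotient st, 2 * m ≤ ((E \ R).filter (Cr (univ.filter fun v => π v = q))).card := by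
      intro q
      obtain ⟨w, hw⟩ := Quotient.exists_rep q
      have hw' : π w = q := hw
      refine (hcut (univ.filter fun v => π v = q) ⟨w, by simp [hw']⟩ ?_).trans ?_
      · intro h2
        apply huv
        have h3 : u0 ∈ univ.filter fun v => π v = q := by rw [h2]; exact mem_univ _
        have h4 : v0 ∈ univ.filter fun v => π v = q := by rw [h2]; exact mem_univ _
        simp only [mem_filter, mem_univ, true_and] at h3 h4
        rw [h3, h4]
      · apply card_le_card
        intro e he
        rw [mem_filter] at he ⊢
        refine ⟨mem_sdiff.mpr ⟨he.1, fun heR => ?_⟩, he.2⟩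
        apply he.2
        simp [hπR e heR]
    have h2 : ∑ q : Quotient st, ((E \ R).filter (Cr (univ.filter fun v => π v = q))).card
        ≤ ∑ e ∈ E \ R, 2 := by
      simp only [card_filter]
      rw [sum_comm]
      refine sum_le_sum fun e he => ?_
      rw [← card_filter]
      refine (card_le_card (t := {π e.1, π e.2}) ?_).trans card_le_two
      intro q hq
      simp only [mem_filter, mem_univ, true_and, Cr] at hq
      simp only [mem_insert, mem_singleton]
      by_contra hcon
      push Not at hcon
      exact hq ⟨fun h => absurd h.symm hcon.1, fun h => absurd h.symm hcon.2⟩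
    have h3 : ∑ q : Quotient st, 2 * m
        ≤ ∑ q : Quotient st, ((E \ R).filter (Cr (univ.filter fun v => π v = q))).card :=
      sum_le_sum fun q _ => h1 q
    simp only [sum_const, card_univ, smul_eq_mul] at h2 h3
    nlinarith
  have hFR : ∀ i, Fintype.card V ≤ (F i ∩ R).card + Q := by
    intro i
    let S := F i ∩ R
    let L : (V → ℚ) →ₗ[ℚ] (S → ℚ) := LinearMap.pi fun e =>
      LinearMap.proj (R := ℚ) (φ := fun _ : V => ℚ) e.1.1 -
        LinearMap.proj (R := ℚ) (φ := fun _ : V => ℚ) e.1.2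
    let M : (Quotient st → ℚ) →ₗ[ℚ] (V → ℚ) := LinearMap.funLeft ℚ ℚ π
    have h1 := LinearMap.finrank_range_add_finrank_ker L
    have h2 : Module.finrank ℚ (LinearMap.range L) ≤ S.card := by
      have := Submodule.finrank_le (LinearMap.range L)
      rw [Module.finrank_pi] at this
      simpa using this
    have h3 : LinearMap.ker L ≤ LinearMap.range M := by
      intro f hf
      have h4 : ∀ e ∈ S, f e.1 = f e.2 := by
        intro e he
        have := congrFun (LinearMap.mem_ker.mp hf) ⟨e, he⟩
        simp [L] at this
        linarith
      have h5 : ∀ e ∈ R, f e.1 = f e.2 := fun e he => fnl_spn h4 (hRs i e he)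
      refine ⟨Quotient.lift f fun u v (h : st.r u v) => h f h5, ?_⟩
      funext v
      rfl
    have h4 := Submodule.finrank_mono h3
    have h5 := LinearMap.finrank_range_le M
    rw [Module.finrank_pi] at h1 h5
    have h6 : S.card = (F i ∩ R).card := rfl
    omega
  have htot : (E \ R).card + ∑ i, (F i ∩ R).card ≤ tot F := by
    unfold tot
    have h1 : ∀ i, (F i).card = (F i \ R).card + (F i ∩ R).card := by
      intro i; rw [card_sdiff_add_card_inter]
    rw [sum_congr rfl fun i _ => h1 i, sum_add_distrib]
    refine Nat.add_le_add_right ?_ _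
    refine (card_le_card (t := univ.biUnion fun i => F i \ R) ?_).trans card_biUnion_le
    intro e he
    rw [mem_sdiff] at he
    rw [mem_biUnion]
    by_contra hcon
    push Not at hcon
    apply he.2
    refine hRu e he.1 fun i hi => ?_
    exact hcon i (mem_univ _) (mem_sdiff.mpr ⟨hi, he.2⟩)
  have hub : tot F + m ≤ m * Fintype.card V := by
    have : ∑ i : Fin m, ((F i).card + 1) ≤ ∑ i : Fin m, Fintype.card V :=
      sum_le_sum fun i _ => ind_card (hF.ind i)
    rw [sum_add_distrib] at this
    simpa [tot] using this
  have hlb : m * Fintype.card V ≤ ∑ i, (F i ∩ R).card + m * Q := by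
    have : ∑ i : Fin m, Fintype.card V ≤ ∑ i : Fin m, ((F i ∩ R).card + Q) :=
      sum_le_sum fun i _ => hFR i
    rw [sum_add_distrib] at this
    simpa using this
  omega

end PartB

section PartC
open Finset

variable {V : Type} [DecidableEq V] [Fintype V]

/-- Indicator of a pair in a set of pairs. -/
def ii (H : Finset (V × V)) (u v : V) : ℤ := if (u, v) ∈ H then 1 else 0

theorem card_fst (S : Finset (V × V)) (v : V) :
    ((S.filter (fun e => e.1 = v)).card : ℤ) = ∑ w, ii S v w := by
  unfold ii
  rw [Finset.sum_boole]
  congr 1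
  refine Finset.card_bij' (fun e _ => e.2) (fun w _ => (v, w)) ?_ ?_ ?_ ?_
  · rintro ⟨a, b⟩ h
    simp only [mem_filter, mem_univ, true_and] at h ⊢
    obtain ⟨h, rfl⟩ := h; exact h
  · intro w h
    simpa using h
  · rintro ⟨a, b⟩ h
    simp only [mem_filter] at h
    simp [h.2]
  · intro w h; rfl

theorem card_snd (S : Finset (V × V)) (v : V) :
    ((S.filter (fun e => e.2 = v)).card : ℤ) = ∑ w, ii S w v := by
  unfold ii
  rw [Finset.sum_boole]
  congr 1
  refine Finset.card_bij' (fun e _ => e.1) (fun w _ => (w, v)) ?_ ?_ ?_ ?_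
  · rintro ⟨a, b⟩ h
    simp only [mem_filter, mem_univ, true_and] at h ⊢
    obtain ⟨h, rfl⟩ := h; exact h
  · intro w h
    simpa using h
  · rintro ⟨a, b⟩ h
    simp only [mem_filter] at h
    simp [h.2]
  · intro w h; rfl

theorem sum_ii (S : Finset (V × V)) : ∑ u, ∑ v, ii S u v = (S.card : ℤ) := by
  unfold ii
  rw [← Finset.sum_product', Finset.univ_product_univ]
  simp

theorem dd_ii (H : Finset (V × V)) (B : Finset V) :
    dd univ B (fun u v => ii H u v + ii H v u) = ((H.filter (Cr B)).card : ℤ) := by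
  rw [← sum_ii]
  unfold dd
  rw [← Finset.sum_add_sum_compl B (fun u => ∑ v, ii (H.filter (Cr B)) u v)]
  have h1 : ∀ u ∈ B, ∑ v, ii (H.filter (Cr B)) u v = ∑ v ∈ univ \ B, ii H u v := by
    intro u hu
    rw [← Finset.sum_add_sum_compl B, Finset.sum_eq_zero, zero_add, ← Finset.compl_eq_univ_sdiff]
    · refine sum_congr rfl fun v hv => ?_
      rw [mem_compl] at hv
      simp [ii, Cr, hu, hv]
    · intro v hv
      simp [ii, Cr, hu, hv]
  have h2 : ∀ u ∈ Bᶜ, ∑ v, ii (H.filter (Cr B)) u v = ∑ v ∈ B, ii H u v := by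
    intro u hu
    rw [mem_compl] at hu
    rw [← Finset.sum_add_sum_compl B, Finset.sum_eq_zero (s := Bᶜ), add_zero]
    · refine sum_congr rfl fun v hv => ?_
      simp [ii, Cr, hu, hv]
    · intro v hv
      rw [mem_compl] at hv
      simp [ii, Cr, hu, hv]
  rw [sum_congr rfl h1, sum_congr rfl h2]
  simp only [sum_add_distrib]
  congr 1
  rw [sum_comm, Finset.compl_eq_univ_sdiff]

theorem orient {k : ℕ} (hk : 3 ≤ k) (A : Finset V) [Nonempty V] (H T1 T2 : Finset (V × V))
    (hH : ∀ e ∈ H, e.1 ∈ A ∧ e.2 ∉ A) (h1 : ∀ e ∈ T1, e.1 ∈ A ∧ e.2 ∉ A)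
    (h2 : ∀ e ∈ T2, e.1 ∈ A ∧ e.2 ∉ A)
    (hcut : ∀ B : Finset V, B.Nonempty → B ≠ univ → 3 * k - 3 ≤ (H.filter (Cr B)).card)
    (hdiv : k ∣ H.card + T1.card + T2.card) :
    ∃ X ⊆ H, (∀ v ∈ A, k ∣ (T1.filter (fun e => e.1 = v)).card
        + (X.filter (fun e => e.1 = v)).card) ∧
      ∀ v ∉ A, k ∣ (T2.filter (fun e => e.2 = v)).card
        + ((H \ X).filter (fun e => e.2 = v)).card := by
  have hk' : (3 : ℤ) ≤ k := by exact_mod_cast hk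
  have hk0 : (0 : ℤ) < k := by omega
  let mm : V → V → ℤ := fun u v => ii H u v + ii H v u
  let p : V → ℤ := fun v => if v ∈ A then -((T1.filter (fun e => e.1 = v)).card : ℤ)
    else -((T2.filter (fun e => e.2 = v)).card : ℤ)
  let t : V → ℤ := fun v => 2 * p v - ∑ w, mm v w
  let c : Cfg V := { m := mm, t := t, a := fun _ => 0, b := fun _ => 0 }
  have hmm : ∑ u, ∑ v, mm u v = 2 * (H.card : ℤ) := by
    simp only [mm, sum_add_distrib]
    rw [sum_comm (f := fun u v => ii H v u), sum_ii]; ring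
  have hp : ∑ v, p v = -((T1.card : ℤ) + T2.card) := by
    have hz : ∀ v, p v = -(((T1.filter (fun e => e.1 = v)).card : ℤ)
        + ((T2.filter (fun e => e.2 = v)).card : ℤ)) := by
      intro v
      simp only [p]
      split_ifs with hv
      · rw [Finset.filter_eq_empty_iff (s := T2) |>.mpr]
        · simp
        · rintro e he rfl
          exact (h2 e he).2 hv
      · rw [Finset.filter_eq_empty_iff (s := T1) |>.mpr]
        · simp
        · rintro e he rfl
          exact hv (h1 e he).1
    rw [sum_congr rfl fun v _ => hz v, sum_neg_distrib, sum_add_distrib]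
    simp only [card_fst, card_snd]
    rw [sum_comm (f := fun v w => ii T2 w v), sum_ii, sum_ii]
  have hpar : ∀ B ⊆ (univ : Finset V), 2 ∣ dd univ B mm + ∑ v ∈ B, t v := by
    intro B _
    have e1 : ∑ v ∈ B, t v = 2 * ∑ v ∈ B, p v - (∑ v ∈ B, ∑ w ∈ B, mm v w + dd univ B mm) := by
      simp only [t, sum_sub_distrib, mul_sum]
      congr 1
      unfold dd
      rw [← sum_add_distrib]
      refine sum_congr rfl fun u _ => ?_
      rw [← Finset.compl_eq_univ_sdiff, Finset.sum_add_sum_compl]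
    have e2 : ∑ v ∈ B, ∑ w ∈ B, mm v w = 2 * ∑ v ∈ B, ∑ w ∈ B, ii H v w := by
      simp only [mm, sum_add_distrib]
      rw [sum_comm (f := fun u v => ii H v u)]; ring
    rw [e1, e2]
    omega
  have hbase : Base (k : ℤ) univ c := by
    refine { sym := ?_, nn := ?_, an := ?_, bn := ?_, tot := ?_, par := hpar, ss := ?_ }
    · intro u v; simp only [c, mm]; ring
    · intro u v; simp only [c, mm, ii]; split_ifs <;> norm_num
    · intro v; simp [c]
    · intro v; simp [c]
    · have : ∑ v, c.t v = -(2 * ((H.card + T1.card + T2.card : ℕ) : ℤ)) := by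
        simp only [c, t, sum_sub_distrib, ← mul_sum]
        rw [hp, hmm]; push_cast; ring
      rw [this, dvd_neg]
      exact mul_dvd_mul_left 2 (Int.natCast_dvd_natCast.mpr hdiv)
    · left; simp [c]; omega
  have hok : ∀ B ⊆ (univ : Finset V), B.Nonempty → B ≠ univ → Ok (k : ℤ) univ c B := by
    intro B hB hne hnu
    have e1 := hpar B hB
    have e2 := hcut B hne hnu
    have e3 : dd univ B mm = ((H.filter (Cr B)).card : ℤ) := dd_ii H B
    have e4 := nu_le_k hk0 (c.ta B)
    have e5 := nu_even hk0 (c.ta B)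
    have e6 : c.ta B = ∑ v ∈ B, t v := by simp [Cfg.ta, c]
    have e7 : c.D univ B = dd univ B mm := by simp [Cfg.D, c]
    unfold Ok
    rw [e7]
    rw [e6] at e4 e5 ⊢
    rw [e3] at e1 ⊢
    generalize (H.filter (Cr B)).card = q at *
    omega
  obtain ⟨o, ho0, ho1, ho2⟩ := (main_all (V := V) hk' _).1 univ c rfl hbase univ_nonempty hok
  have ho0 : ∀ u v, 0 ≤ o u v := fun u v => ho0 u (mem_univ _) v (mem_univ _)
  have ho1 : ∀ u v, u ≠ v → o u v + o v u = mm u v :=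
    fun u v => ho1 u (mem_univ _) v (mem_univ _)
  have hdiag : ∀ v, mm v v = 0 := by
    intro v
    have : (v, v) ∉ H := fun h => (hH _ h).2 (hH _ h).1
    simp [mm, ii, this]
  let o' : V → V → ℤ := fun u v => if u = v then 0 else o u v
  have hout : ∀ v, (k : ℤ) ∣ ∑ w, o' v w - p v := by
    intro v
    have e1 := ho2 v (mem_univ _)
    have e2 : ∑ w, (o v w - o w v) - c.t v = 2 * (∑ w, o' v w - p v) := by
      have : ∑ w, (o v w - o w v) = ∑ w, (2 * o' v w - mm v w) := by
        refine sum_congr rfl fun w _ => ?_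
        by_cases hw : v = w
        · subst hw; simp [o', hdiag]
        · have := ho1 v w hw
          simp only [o', if_neg hw]; omega
      rw [this, sum_sub_distrib, ← mul_sum]
      simp only [c, t]; ring
    rw [e2] at e1
    exact Int.dvd_of_mul_dvd_mul_left (by norm_num) e1
  refine ⟨H.filter (fun e => o e.1 e.2 = 1), filter_subset _ _, ?_, ?_⟩
  · intro v hv
    have e1 := hout v
    have e2 : ∑ w, o' v w = ∑ w, ii (H.filter (fun e => o e.1 e.2 = 1)) v w := by
      refine sum_congr rfl fun w _ => ?_
      have n1 : (w, v) ∉ H := fun h => (hH _ h).2 hv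
      by_cases hw : v = w
      · subst hw; simp [o', ii, n1]
      · have a1 := ho1 v w hw
        have a2 := ho0 v w
        have a3 := ho0 w v
        simp only [o', if_neg hw, ii, mem_filter]
        simp only [mm, ii, n1, if_false] at a1
        by_cases hin : (v, w) ∈ H
        · simp only [hin, if_true, true_and] at a1 ⊢
          split_ifs <;> omega
        · simp only [hin, if_false, false_and] at a1 ⊢
          omega
    rw [e2, ← card_fst] at e1
    simp only [p, if_pos hv, sub_neg_eq_add] at e1
    rw [add_comm]
    exact_mod_cast e1
  · intro v hv
    have e1 := hout v
    have e2 : ∑ w, o' v w = ∑ w, ii (H \ H.filter (fun e => o e.1 e.2 = 1)) w v := by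
      refine sum_congr rfl fun w _ => ?_
      have n1 : (v, w) ∉ H := fun h => hv (hH _ h).1
      by_cases hw : v = w
      · subst hw; simp [o', ii, n1]
      · have a1 := ho1 v w hw
        have a2 := ho0 v w
        have a3 := ho0 w v
        simp only [o', if_neg hw, ii, mem_filter, mem_sdiff]
        simp only [mm, ii, n1, if_false] at a1
        by_cases hin : (w, v) ∈ H
        · simp only [hin, if_true, true_and] at a1 ⊢
          split_ifs <;> omega
        · simp only [hin, if_false, false_and] at a1 ⊢
          omega
    rw [e2, ← card_snd] at e1
    simp only [p, if_neg hv, sub_neg_eq_add] at e1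
    rw [add_comm]
    exact_mod_cast e1

end PartC

section PartD
open Finset

theorem connected_of_cuts {V : Type} [Fintype V] [Nonempty V] (G : SimpleGraph V)
    (h : ∀ B : Finset V, B.Nonempty → B ≠ univ → ∃ u ∈ B, ∃ v, v ∉ B ∧ G.Adj u v) :
    G.Connected := by
  classical
  obtain ⟨x⟩ := ‹Nonempty V›
  have key : (univ.filter fun y => G.Reachable x y) = (univ : Finset V) := by
    by_contra hne
    obtain ⟨u, hu, v, hv, huv⟩ := h _ ⟨x, by simp⟩ hne
    simp only [mem_filter, mem_univ, true_and] at hu hv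
    exact hv (hu.trans huv.reachable)
  have hx : ∀ y, G.Reachable x y := by
    intro y
    have : y ∈ (univ.filter fun y => G.Reachable x y) := by rw [key]; exact mem_univ _
    simpa using this
  have : Nonempty V := ⟨x⟩
  exact SimpleGraph.Connected.mk fun a b => (hx a).symm.trans (hx b)

theorem cut_of_connected {V : Type} [Fintype V] {G : SimpleGraph V} (hG : G.Connected)
    {B : Finset V} (hB : B.Nonempty) (hB' : B ≠ univ) : ∃ u ∈ B, ∃ v, v ∉ B ∧ G.Adj u v := by
  obtain ⟨x, hx⟩ := hB
  obtain ⟨y, hy⟩ : ∃ y, y ∉ B := by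
    by_contra hcon
    push Not at hcon
    exact hB' (eq_univ_iff_forall.mpr hcon)
  obtain ⟨w⟩ := hG.preconnected x y
  obtain ⟨d, _, h1, h2⟩ := w.exists_boundary_dart (B : Set V) hx hy
  exact ⟨d.fst, h1, d.snd, h2, d.adj⟩

/-- The graph of a set of pairs. -/
def gr {V : Type} (S : Finset (V × V)) : SimpleGraph V where
  Adj u v := u ≠ v ∧ ((u, v) ∈ S ∨ (v, u) ∈ S)
  symm := ⟨fun _ _ h => ⟨h.1.symm, h.2.symm⟩⟩
  loopless := ⟨fun _ h => h.1 rfl⟩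

theorem s_inj {V : Type} {A : Finset V} {S : Finset (V × V)} (hS : ∀ e ∈ S, e.1 ∈ A ∧ e.2 ∉ A)
    {e f : V × V} (he : e ∈ S) (hf : f ∈ S) (h : s(e.1, e.2) = s(f.1, f.2)) : e = f := by
  rw [Sym2.eq_iff] at h
  rcases h with ⟨h1, h2⟩ | ⟨h1, h2⟩
  · exact Prod.ext h1 h2
  · exact absurd (h1 ▸ (hS e he).1) (hS f hf).2

theorem gr_conn {V : Type} [Fintype V] [Nonempty V] [DecidableEq V] {A : Finset V}
    {S : Finset (V × V)}
    (hS : ∀ e ∈ S, e.1 ∈ A ∧ e.2 ∉ A) {r : ℕ} (T : Fin r → Finset (V × V))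
    (hT : ∀ i, T i ⊆ S) (hd : ∀ i j, i ≠ j → Disjoint (T i) (T j))
    (hc : ∀ i, ∀ B : Finset V, B.Nonempty → B ≠ univ → ∃ e ∈ T i, Cr B e) :
    IsKEdgeConnected (gr S) r := by
  intro D hD
  apply connected_of_cuts
  intro B hB hB'
  choose e he hcr using fun i => hc i B hB hB'
  by_contra hcon
  push Not at hcon
  have hall : ∀ i, s((e i).1, (e i).2) ∈ D := by
    intro i
    by_contra hn
    have hne : (e i).1 ≠ (e i).2 := by
      intro h
      have := hS _ (hT i (he i))
      rw [h] at this
      exact this.2 this.1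
    have hadj : ((gr S).deleteEdges ↑D).Adj (e i).1 (e i).2 := by
      rw [deleteEdges_adj]
      exact ⟨⟨hne, Or.inl (hT i (he i))⟩, by simpa using hn⟩
    have := hcr i
    unfold Cr at this
    by_cases h1 : (e i).1 ∈ B
    · by_cases h2 : (e i).2 ∈ B
      · exact this (by simp [h1, h2])
      · exact hcon _ h1 _ h2 hadj
    · by_cases h2 : (e i).2 ∈ B
      · exact hcon _ h2 _ h1 hadj.symm
      · exact this (by simp [h1, h2])
  have hle : (univ : Finset (Fin r)).card ≤ D.card := by
    refine card_le_card_of_injOn (fun i => s((e i).1, (e i).2)) (fun i _ => hall i) ?_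
    intro i _ j _ hij
    by_contra hne
    have := s_inj hS (hT i (he i)) (hT j (he j)) hij
    exact Finset.disjoint_left.mp (hd i j hne) (he i) (this ▸ he j)
  simp at hle
  omega

theorem gr_nbr_fst {V : Type} [DecidableEq V] {A : Finset V} {S : Finset (V × V)}
    (hS : ∀ e ∈ S, e.1 ∈ A ∧ e.2 ∉ A) {v : V} (hv : v ∈ A) :
    ((gr S).neighborSet v).ncard = (S.filter (fun e => e.1 = v)).card := by
  have : (gr S).neighborSet v = ((S.filter (fun e => e.1 = v)).image Prod.snd : Finset V) := by
    ext w
    simp only [mem_neighborSet, gr, coe_image, Set.mem_image, mem_coe, mem_filter, Prod.exists]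
    constructor
    · rintro ⟨hne, h | h⟩
      · exact ⟨v, w, ⟨h, rfl⟩, rfl⟩
      · exact absurd hv (hS _ h).2
    · rintro ⟨a, b, ⟨h, rfl⟩, rfl⟩
      refine ⟨?_, Or.inl h⟩
      rintro rfl
      exact (hS _ h).2 (hS _ h).1
  rw [this, Set.ncard_coe_finset, card_image_of_injOn]
  rintro ⟨a, b⟩ h ⟨a', b'⟩ h' hh
  simp at h h' hh
  rw [h.2, h'.2, hh]

theorem gr_nbr_snd {V : Type} [DecidableEq V] {A : Finset V} {S : Finset (V × V)}
    (hS : ∀ e ∈ S, e.1 ∈ A ∧ e.2 ∉ A) {v : V} (hv : v ∉ A) :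
    ((gr S).neighborSet v).ncard = (S.filter (fun e => e.2 = v)).card := by
  have : (gr S).neighborSet v = ((S.filter (fun e => e.2 = v)).image Prod.fst : Finset V) := by
    ext w
    simp only [mem_neighborSet, gr, coe_image, Set.mem_image, mem_coe, mem_filter, Prod.exists]
    constructor
    · rintro ⟨hne, h | h⟩
      · exact absurd (hS _ h).1 hv
      · exact ⟨w, v, ⟨h, rfl⟩, rfl⟩
    · rintro ⟨a, b, ⟨h, rfl⟩, rfl⟩
      refine ⟨?_, Or.inr h⟩
      rintro rfl
      exact (hS _ h).2 (hS _ h).1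
  rw [this, Set.ncard_coe_finset, card_image_of_injOn]
  rintro ⟨a, b⟩ h ⟨a', b'⟩ h' hh
  simp at h h' hh
  rw [h.2, h'.2, hh]

theorem gr_edges {V : Type} {A : Finset V} {S : Finset (V × V)}
    (hS : ∀ e ∈ S, e.1 ∈ A ∧ e.2 ∉ A) : (gr S).edgeSet.ncard = S.card := by
  classical
  have : (gr S).edgeSet = (S.image (fun e => s(e.1, e.2)) : Finset (Sym2 V)) := by
    ext x
    induction x with
    | h u v =>
      simp only [mem_edgeSet, gr, coe_image, Set.mem_image, mem_coe, Prod.exists]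
      constructor
      · rintro ⟨hne, h | h⟩
        · exact ⟨u, v, h, rfl⟩
        · exact ⟨v, u, h, Sym2.eq_swap⟩
      · rintro ⟨a, b, h, hh⟩
        have hab : a ≠ b := by
          rintro rfl
          exact (hS _ h).2 (hS _ h).1
        rw [Sym2.eq_iff] at hh
        rcases hh with ⟨rfl, rfl⟩ | ⟨rfl, rfl⟩
        · exact ⟨hab, Or.inl h⟩
        · exact ⟨hab.symm, Or.inr h⟩
  rw [this, Set.ncard_coe_finset, card_image_of_injOn]
  intro e he f hf h
  exact s_inj hS he hf h

theorem decomp_core {V : Type} [Fintype V] [Nonempty V] [DecidableEq V] (k r : ℕ) (hk3 : 3 ≤ k)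
    (A : Finset V) (E : Finset (V × V)) (hE : ∀ e ∈ E, e.1 ∈ A ∧ e.2 ∉ A)
    (hcut : ∀ B : Finset V, B.Nonempty → B ≠ univ →
      6 * k - 6 + 4 * r ≤ (E.filter (Cr B)).card)
    (hdiv : k ∣ E.card) :
    ∃ S₁ S₂ : Finset (V × V), S₁ ∪ S₂ = E ∧ Disjoint S₁ S₂ ∧
      IsKEdgeConnected (gr S₁) r ∧ IsKEdgeConnected (gr S₂) r ∧
      (∀ v ∈ A, k ∣ ((gr S₁).neighborSet v).ncard) ∧
      (∀ v ∉ A, k ∣ ((gr S₂).neighborSet v).ncard) := by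
  obtain ⟨F, hFE, hFd, hFc⟩ := tree_packing E (r + r + (3 * k - 3)) (by
    intro B hB hB'
    have := hcut B hB hB'
    omega)
  let F1 : Fin r → Finset (V × V) := fun i => F ⟨i, by omega⟩
  let F2 : Fin r → Finset (V × V) := fun i => F ⟨r + i, by omega⟩
  let F3 : Fin (3 * k - 3) → Finset (V × V) := fun i => F ⟨r + r + i, by omega⟩
  let T1 := univ.biUnion F1
  let T2 := univ.biUnion F2
  let H := E \ (T1 ∪ T2)
  have hT1 : T1 ⊆ E := biUnion_subset.mpr fun i _ => hFE _
  have hT2 : T2 ⊆ E := biUnion_subset.mpr fun i _ => hFE _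
  have hT12 : Disjoint T1 T2 := by
    rw [disjoint_biUnion_left]
    intro i _
    rw [disjoint_biUnion_right]
    intro j _
    apply hFd
    rw [Ne, Fin.mk.injEq]
    omega
  have hHE : H ⊆ E := sdiff_subset
  have hHT : Disjoint H (T1 ∪ T2) := sdiff_disjoint
  have hHT1 : Disjoint T1 H := (hHT.mono_right subset_union_left).symm
  have hHT2 : Disjoint T2 H := (hHT.mono_right subset_union_right).symm
  have hF3 : ∀ i, F3 i ⊆ H := by
    intro i e he
    refine mem_sdiff.mpr ⟨hFE _ he, ?_⟩
    rw [mem_union, mem_biUnion, mem_biUnion]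
    rintro (⟨j, _, hj⟩ | ⟨j, _, hj⟩)
    · refine Finset.disjoint_left.mp (hFd _ _ ?_) he hj
      rw [Ne, Fin.mk.injEq]; omega
    · refine Finset.disjoint_left.mp (hFd _ _ ?_) he hj
      rw [Ne, Fin.mk.injEq]; omega
  have hcard : H.card + T1.card + T2.card = E.card := by
    have a1 : (T1 ∪ T2).card = T1.card + T2.card := card_union_of_disjoint hT12
    have a2 : H.card + (T1 ∪ T2).card = E.card :=
      card_sdiff_add_card_eq_card (union_subset hT1 hT2)
    omega
  obtain ⟨X, hXH, hX1, hX2⟩ := orient hk3 A H T1 T2 (fun e he => hE e (hHE he))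
    (fun e he => hE e (hT1 he)) (fun e he => hE e (hT2 he)) (by
      intro B hB hB'
      choose e he hcr using fun i : Fin (3 * k - 3) => hFc ⟨r + r + i, by omega⟩ B hB hB'
      have hle : (univ : Finset (Fin (3 * k - 3))).card ≤ (H.filter (Cr B)).card := by
        refine card_le_card_of_injOn e (fun i _ => ?_) ?_
        · exact mem_coe.mpr (mem_filter.mpr ⟨hF3 i (he i), hcr i⟩)
        · intro i _ j _ hij
          by_contra hne
          refine Finset.disjoint_left.mp (hFd _ _ ?_) (he i) (hij ▸ he j)
          rw [Ne, Fin.mk.injEq]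
          intro h
          exact hne (Fin.ext (by omega))
      simpa using hle) (by rw [hcard]; exact hdiv)
  have hS1 : T1 ∪ X ⊆ E := union_subset hT1 (hXH.trans hHE)
  have hS2 : T2 ∪ (H \ X) ⊆ E := union_subset hT2 (sdiff_subset.trans hHE)
  refine ⟨T1 ∪ X, T2 ∪ (H \ X), ?_, ?_, ?_, ?_, ?_, ?_⟩
  · apply subset_antisymm (union_subset hS1 hS2)
    intro e he
    by_cases b1 : e ∈ T1
    · simp [b1]
    by_cases b2 : e ∈ T2
    · simp [b2]
    by_cases b3 : e ∈ X
    · simp [b3]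
    have : e ∈ H := by simp [H, he, b1, b2]
    simp [this, b3]
  · rw [disjoint_union_left, disjoint_union_right, disjoint_union_right]
    exact ⟨⟨hT12, hHT1.mono_right sdiff_subset⟩, (hHT2.mono_right hXH).symm, disjoint_sdiff⟩
  · refine gr_conn (A := A) (fun e he => hE e (hS1 he)) F1 ?_ ?_ ?_
    · intro i
      exact (subset_biUnion_of_mem F1 (mem_univ i)).trans subset_union_left
    · intro i j hij
      apply hFd
      rw [Ne, Fin.mk.injEq]
      exact fun h => hij (Fin.ext h)
    · exact fun i => hFc _
  · refine gr_conn (A := A) (fun e he => hE e (hS2 he)) F2 ?_ ?_ ?_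
    · intro i
      exact (subset_biUnion_of_mem F2 (mem_univ i)).trans subset_union_left
    · intro i j hij
      apply hFd
      rw [Ne, Fin.mk.injEq]
      exact fun h => hij (Fin.ext (by omega))
    · exact fun i => hFc _
  · intro v hv
    rw [gr_nbr_fst (A := A) (fun e he => hE e (hS1 he)) hv, filter_union,
      card_union_of_disjoint (disjoint_filter_filter (hHT1.mono_right hXH))]
    exact hX1 v hv
  · intro v hv
    rw [gr_nbr_snd (A := A) (fun e he => hE e (hS2 he)) hv, filter_union,
      card_union_of_disjoint (disjoint_filter_filter (hHT2.mono_right sdiff_subset))]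
    exact hX2 v hv

end PartD

/-- Let `k ≥ 3` be odd and `r` a natural number.  If `G` is a `(6k-6+4r)`-edge-connected
bipartite finite graph with vertex classes `A₁` (the set `A`) and `A₂ = Aᶜ`, and `|E(G)|`
is divisible by `k`, then `G` decomposes into two spanning `r`-edge-connected subgraphs
`G₁`, `G₂` such that the degree in `Gᵢ` of every vertex of `Aᵢ` is divisible by `k`. -/
theorem bipartite_decomposition_into_edge_connected_parts
    {V : Type} [Fintype V] (k r : ℕ) (hk3 : 3 ≤ k) (hkodd : Odd k)
    (G : SimpleGraph V) (A : Set V)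
    (hbip : ∀ u v, G.Adj u v → (u ∈ A ↔ v ∉ A))
    (hconn : IsKEdgeConnected G (6 * k - 6 + 4 * r))
    (hdiv : k ∣ G.edgeSet.ncard) :
    ∃ G₁ G₂ : SimpleGraph V,
      G₁ ⊔ G₂ = G ∧ Disjoint G₁.edgeSet G₂.edgeSet ∧
      IsKEdgeConnected G₁ r ∧ IsKEdgeConnected G₂ r ∧
      (∀ v ∈ A, k ∣ (G₁.neighborSet v).ncard) ∧
      (∀ v ∉ A, k ∣ (G₂.neighborSet v).ncard) := by
  classical
  have hne : Nonempty V := (hconn ∅ (by simp; omega)).nonempty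
  let A' : Finset V := Finset.univ.filter (fun v => v ∈ A)
  have hA' : ∀ v, v ∈ A' ↔ v ∈ A := fun v => by simp [A']
  let E : Finset (V × V) := Finset.univ.filter (fun e => e.1 ∈ A ∧ G.Adj e.1 e.2)
  have hE' : ∀ u v, (u, v) ∈ E ↔ u ∈ A ∧ G.Adj u v := fun u v => by simp [E]
  have hE : ∀ e ∈ E, e.1 ∈ A' ∧ e.2 ∉ A' := by
    rintro ⟨u, v⟩ h
    rw [hE'] at h
    simp only [hA']
    exact ⟨h.1, (hbip u v h.2).mp h.1⟩
  have hadj : ∀ u v, G.Adj u v → (u, v) ∈ E ∨ (v, u) ∈ E := by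
    intro u v h
    by_cases hu : u ∈ A
    · exact Or.inl ((hE' u v).mpr ⟨hu, h⟩)
    · refine Or.inr ((hE' v u).mpr ⟨?_, h.symm⟩)
      by_contra hv
      exact hu ((hbip u v h).mpr hv)
  have hgr : gr E = G := by
    ext u v
    constructor
    · rintro ⟨_, h | h⟩
      · exact ((hE' u v).mp h).2
      · exact ((hE' v u).mp h).2.symm
    · intro h
      exact ⟨h.ne, hadj u v h⟩
  have hcut : ∀ B : Finset V, B.Nonempty → B ≠ Finset.univ →
      6 * k - 6 + 4 * r ≤ (E.filter (Cr B)).card := by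
    intro B hB hB'
    by_contra hlt
    push Not at hlt
    let D : Finset (Sym2 V) := (E.filter (Cr B)).image (fun e => s(e.1, e.2))
    have hD : D.card < 6 * k - 6 + 4 * r := lt_of_le_of_lt Finset.card_image_le hlt
    obtain ⟨u, hu, v, hv, h⟩ := cut_of_connected (hconn D hD) hB hB'
    rw [deleteEdges_adj] at h
    apply h.2
    simp only [D, Finset.coe_image, Set.mem_image, Finset.mem_coe, Finset.mem_filter]
    rcases hadj u v h.1 with h' | h'
    · exact ⟨(u, v), ⟨h', by simp [Cr, hu, hv]⟩, rfl⟩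
    · exact ⟨(v, u), ⟨h', by simp [Cr, hu, hv]⟩, Sym2.eq_swap⟩
  have hcard : k ∣ E.card := by
    rw [← gr_edges hE, hgr]; exact hdiv
  obtain ⟨S₁, S₂, hun, hdis, c1, c2, d1, d2⟩ := decomp_core k r hk3 A' E hE hcut hcard
  refine ⟨gr S₁, gr S₂, ?_, ?_, c1, c2, fun v hv => d1 v ((hA' v).mpr hv),
    fun v hv => d2 v (fun h => hv ((hA' v).mp h))⟩
  · rw [← hgr, ← hun]
    ext u v
    simp only [sup_adj, gr, Finset.mem_union]
    tauto
  · have i1 : S₁ ⊆ E := hun ▸ Finset.subset_union_left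
    have i2 : S₂ ⊆ E := hun ▸ Finset.subset_union_right
    rw [Set.disjoint_left]
    intro x
    induction x with
    | h u v =>
      rintro ⟨_, h | h⟩ ⟨_, h' | h'⟩
      · exact Finset.disjoint_left.mp hdis h h'
      · exact (hE _ (i2 h')).2 (hE _ (i1 h)).1
      · exact (hE _ (i2 h')).2 (hE _ (i1 h)).1
      · exact Finset.disjoint_left.mp hdis h h'
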